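/- arXiv:1410.7087 — 2 statements merged into one kernel-verified Lean document; each statement's English description precedes it below -/
import Mathlib

section
/- Let ℓ, m be integers with 8 ≤ ℓ ≤ m, and let k be an integer with 2 ≤ k ≤ ℓm/2. Define n = 2⌊(ℓ−8)/2⌋ if ℓm is even, and n = 2⌊(ℓ−8)/2⌋ − 1 if ℓm is odd, and assume n ≥ 1. Let v = min(k, n²/2) as a real number. Then p_k(ℓ,m) − p_{k−1}(ℓ,m) ≥ C · 2^{√(2v)} / (2v)^{9/4}, where C = 3√3/(2√2 · π^{3/2}). -/
/-- `p k l m`: the number of partitions of `k` fitting in an `l × m` rectangle,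
i.e. with at most `l` parts, each part of size at most `m`. Equivalently, the
coefficient of `q^k` in the Gaussian binomial coefficient `C(l+m, m)_q`. -/
def p (k l m : ℕ) : ℕ :=
  Fintype.card {π : Nat.Partition k // π.parts.card ≤ l ∧ ∀ x ∈ π.parts, x ≤ m}

section
open MvPolynomial

namespace QB

/-- weights -/
def wt (m : ℕ) : Fin (m+1) → ℕ × ℕ := fun i => (1, (i : ℕ))

/-- bihomogeneous space -/
noncomputable def W (m l k : ℕ) : Submodule ℝ (MvPolynomial (Fin (m+1)) ℝ) :=
  weightedHomogeneousSubmodule ℝ (wt m) (l, k)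

/-- lowering -/
noncomputable def D (m : ℕ) : Derivation ℝ (MvPolynomial (Fin (m+1)) ℝ) (MvPolynomial (Fin (m+1)) ℝ) :=
  mkDerivation ℝ (fun i : Fin (m+1) => ((i : ℕ) : ℝ) • X ⟨(i : ℕ) - 1, by omega⟩)

/-- raising -/
noncomputable def U (m : ℕ) : Derivation ℝ (MvPolynomial (Fin (m+1)) ℝ) (MvPolynomial (Fin (m+1)) ℝ) :=
  mkDerivation ℝ (fun i : Fin (m+1) => ((m : ℝ) - ((i : ℕ) : ℝ)) • X ⟨min ((i : ℕ) + 1) m, by omega⟩)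

lemma wt_weight (m : ℕ) (d : Fin (m+1) →₀ ℕ) :
    Finsupp.weight (wt m) d = (∑ i, d i, ∑ i, d i * (i : ℕ)) := by
  rw [Finsupp.weight_apply, Finsupp.sum_fintype _ _ (by simp)]
  ext
  · simp [wt, Prod.fst_sum]
  · simp [wt, Prod.snd_sum]

lemma mem_W {m l k : ℕ} {F : MvPolynomial (Fin (m+1)) ℝ} :
    F ∈ W m l k ↔ ∀ d, coeff d F ≠ 0 → (∑ i, d i = l ∧ ∑ i, d i * (i : ℕ) = k) := by
  rw [W, mem_weightedHomogeneousSubmodule, IsWeightedHomogeneous]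
  simp only [wt_weight, Prod.mk.injEq]

lemma W_le_of_monomial {m l k : ℕ} (T : MvPolynomial (Fin (m+1)) ℝ →ₗ[ℝ] MvPolynomial (Fin (m+1)) ℝ)
    (S : Submodule ℝ (MvPolynomial (Fin (m+1)) ℝ))
    (h : ∀ d : Fin (m+1) →₀ ℕ, Finsupp.weight (wt m) d = (l, k) → T (monomial d 1) ∈ S)
    {F : MvPolynomial (Fin (m+1)) ℝ} (hF : F ∈ W m l k) : T F ∈ S := by
  rw [F.as_sum, map_sum]
  refine S.sum_mem fun d hd => ?_
  have : monomial d (coeff d F) = coeff d F • monomial d (1 : ℝ) := by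
    rw [smul_monomial]; simp
  rw [this, map_smul]
  exact S.smul_mem _ (h d (hF (mem_support_iff.mp hd)))

lemma sub_single_weight {m : ℕ} (d : Fin (m+1) →₀ ℕ) (i : Fin (m+1)) (hi : d i ≠ 0) :
    Finsupp.weight (wt m) (d - Finsupp.single i 1) + wt m i = Finsupp.weight (wt m) d := by
  have h : d - Finsupp.single i 1 + Finsupp.single i 1 = d := by
    apply tsub_add_cancel_of_le
    rw [Finsupp.single_le_iff]; omega
  conv_rhs => rw [← h]
  rw [map_add]
  simp [Finsupp.weight_single]

lemma D_mem {m l k : ℕ} {F : MvPolynomial (Fin (m+1)) ℝ} (hF : F ∈ W m l (k+1)) :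
    D m F ∈ W m l k := by
  refine W_le_of_monomial (D m).toLinearMap _ (fun d hd => ?_) hF
  change D m _ ∈ _
  rw [D, mkDerivation_monomial, one_smul]
  refine Submodule.sum_mem _ fun i hi => ?_
  have hi' : d i ≠ 0 := by simpa using hi
  have hw := sub_single_weight d i hi'
  rw [hd] at hw
  simp only [smul_eq_mul, mul_smul_comm]
  by_cases h0 : (i : ℕ) = 0
  · have hr : ((i : ℕ) : ℝ) = 0 := by rw [h0]; try simp
    rw [hr]; simp
  refine Submodule.smul_mem _ _ ?_
  rw [W, mem_weightedHomogeneousSubmodule]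
  have h1 := (isWeightedHomogeneous_monomial (wt m) (d - Finsupp.single i 1) ((d i : ℕ) : ℝ) rfl).mul
    (isWeightedHomogeneous_X ℝ (wt m) ⟨(i : ℕ) - 1, by omega⟩)
  convert h1 using 1
  rw [Prod.ext_iff] at hw ⊢
  simp [wt] at hw ⊢
  omega

lemma D_zero {m l : ℕ} {F : MvPolynomial (Fin (m+1)) ℝ} (hF : F ∈ W m l 0) :
    D m F = 0 := by
  rw [← Submodule.mem_bot ℝ]
  refine W_le_of_monomial (D m).toLinearMap _ (fun d hd => ?_) hF
  change D m _ ∈ _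
  rw [D, mkDerivation_monomial, one_smul]
  refine Submodule.sum_mem _ fun i hi => ?_
  have hi' : d i ≠ 0 := by simpa using hi
  have hw := sub_single_weight d i hi'
  rw [hd] at hw
  simp only [smul_eq_mul, mul_smul_comm]
  have h0 : (i : ℕ) = 0 := by
    rw [Prod.ext_iff] at hw
    simp [wt] at hw
    simp [hw.2.2]
  have hr : ((i : ℕ) : ℝ) = 0 := by rw [h0]; simp
  rw [hr]; simp

lemma U_mem {m l k : ℕ} {F : MvPolynomial (Fin (m+1)) ℝ} (hF : F ∈ W m l k) :
    U m F ∈ W m l (k+1) := by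
  refine W_le_of_monomial (U m).toLinearMap _ (fun d hd => ?_) hF
  change U m _ ∈ _
  rw [U, mkDerivation_monomial, one_smul]
  refine Submodule.sum_mem _ fun i hi => ?_
  have hi' : d i ≠ 0 := by simpa using hi
  have hw := sub_single_weight d i hi'
  rw [hd] at hw
  simp only [smul_eq_mul, mul_smul_comm]
  by_cases h0 : (i : ℕ) = m
  · have hr : ((i : ℕ) : ℝ) = (m : ℝ) := by rw [h0]; try simp
    rw [hr]; simp
  refine Submodule.smul_mem _ _ ?_
  rw [W, mem_weightedHomogeneousSubmodule]
  have h1 := (isWeightedHomogeneous_monomial (wt m) (d - Finsupp.single i 1) ((d i : ℕ) : ℝ) rfl).mul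
    (isWeightedHomogeneous_X ℝ (wt m) ⟨min ((i : ℕ) + 1) m, by omega⟩)
  convert h1 using 1
  rw [Prod.ext_iff] at hw ⊢
  simp [wt] at hw ⊢
  omega

lemma comm_eq (m : ℕ) : ⁅D m, U m⁆ =
    mkDerivation ℝ (fun i : Fin (m+1) => ((m : ℝ) - 2 * ((i : ℕ) : ℝ)) • X i) := by
  apply derivation_ext
  intro i
  rw [Derivation.commutator_apply, mkDerivation_X]
  rw [D, U, mkDerivation_X, mkDerivation_X]
  rw [Derivation.map_smul, Derivation.map_smul, mkDerivation_X, mkDerivation_X]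
  rcases eq_or_ne (i : ℕ) m with h | h <;> rcases eq_or_ne (i : ℕ) 0 with h' | h'
  · have : (m : ℝ) = 0 := by rw [← h, h']; simp
    simp [h', this]
  · have e : (⟨min ((i : ℕ) - 1 + 1) m, by omega⟩ : Fin (m+1)) = i := by
      ext; simp; omega
    have h2 : (((i : ℕ) - 1 : ℕ) : ℝ) = (i : ℕ) - 1 := by
      rw [Nat.cast_sub (by omega)]; simp
    have hr : ((i : ℕ) : ℝ) = m := by rw [h]
    simp only [e, h2, hr]
    module
  · have e : (⟨min ((i : ℕ) + 1) m - 1, by omega⟩ : Fin (m+1)) = i := by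
      ext; simp; omega
    have h2 : ((min ((i : ℕ) + 1) m : ℕ) : ℝ) = (i : ℕ) + 1 := by
      rw [min_eq_left (by omega)]; simp
    simp only [e, h2]
    simp [h']
  · have e : (⟨min ((i : ℕ) - 1 + 1) m, by omega⟩ : Fin (m+1)) = i := by
      ext; simp; omega
    have h2 : (((i : ℕ) - 1 : ℕ) : ℝ) = (i : ℕ) - 1 := by
      rw [Nat.cast_sub (by omega)]; simp
    have e' : (⟨min ((i : ℕ) + 1) m - 1, by omega⟩ : Fin (m+1)) = i := by
      ext; simp; omega
    have h2' : ((min ((i : ℕ) + 1) m : ℕ) : ℝ) = (i : ℕ) + 1 := by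
      rw [min_eq_left (by omega)]; simp
    simp only [e, h2, e', h2']
    module

lemma H_eigen {m l k : ℕ} {F : MvPolynomial (Fin (m+1)) ℝ} (hF : F ∈ W m l k) :
    D m (U m F) = U m (D m F) + ((l : ℝ) * m - 2 * k) • F := by
  have key : (⁅D m, U m⁆).toLinearMap F - ((l : ℝ) * m - 2 * k) • F = 0 := by
    rw [← Submodule.mem_bot ℝ]
    refine W_le_of_monomial ((⁅D m, U m⁆).toLinearMap - ((l : ℝ) * m - 2 * k) • LinearMap.id) _
      (fun d hd => ?_) hF
    change ⁅D m, U m⁆ (monomial d 1) - ((l : ℝ) * m - 2 * k) • (monomial d 1) ∈ _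
    rw [Submodule.mem_bot, sub_eq_zero, comm_eq, mkDerivation_monomial, one_smul,
      Finsupp.sum_fintype _ _ (by simp)]
    have : ∀ i : Fin (m+1), (monomial (d - Finsupp.single i 1) ((d i : ℕ) : ℝ)) •
        (((m : ℝ) - 2 * ((i : ℕ) : ℝ)) • (X i : MvPolynomial (Fin (m+1)) ℝ)) =
        ((d i : ℝ) * ((m : ℝ) - 2 * ((i : ℕ) : ℝ))) • monomial d 1 := by
      intro i
      by_cases hi : d i = 0
      · simp [hi]
      have h : d - Finsupp.single i 1 + Finsupp.single i 1 = d := by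
        apply tsub_add_cancel_of_le
        rw [Finsupp.single_le_iff]; omega
      rw [smul_eq_mul, mul_smul_comm, X, monomial_mul, h, smul_monomial, smul_monomial]
      congr 1
      simp; ring
    rw [Finset.sum_congr rfl (fun i _ => this i), ← Finset.sum_smul]
    congr 1
    rw [wt_weight, Prod.mk.injEq] at hd
    rw [← hd.1, ← hd.2]
    push_cast
    rw [Finset.sum_mul, Finset.mul_sum, ← Finset.sum_sub_distrib]
    exact Finset.sum_congr rfl fun i _ => by ring
  have : ⁅D m, U m⁆ F = ((l : ℝ) * m - 2 * k) • F := sub_eq_zero.mp key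
  rw [Derivation.commutator_apply] at this
  rw [← this]; abel

lemma W_bot {m l k : ℕ} (h : l * m < k) {F : MvPolynomial (Fin (m+1)) ℝ} (hF : F ∈ W m l k) :
    F = 0 := by
  ext d
  by_contra hd
  obtain ⟨h1, h2⟩ := mem_W.mp hF d hd
  have : ∑ i, d i * (i : ℕ) ≤ ∑ i, d i * m :=
    Finset.sum_le_sum fun i _ => Nat.mul_le_mul_left _ (by omega)
  rw [← Finset.sum_mul, h1, h2] at this
  omega

end QB

end

section
open MvPolynomial

namespace QB

lemma DU_pow {m l : ℕ} (s : ℕ) : ∀ (k : ℕ) (F : MvPolynomial (Fin (m+1)) ℝ), F ∈ W m l k →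
    ((D m).toLinearMap ^ (s+1)) (U m F) = U m (((D m).toLinearMap ^ (s+1)) F)
      + (((s : ℝ) + 1) * ((l : ℝ) * m - 2 * k + s)) • ((D m).toLinearMap ^ s) F := by
  induction s with
  | zero =>
    intro k F hF
    simpa using H_eigen hF
  | succ s ih =>
    intro k F hF
    rw [pow_succ, Module.End.mul_apply, Derivation.coeFn_coe, H_eigen hF, map_add, map_smul]
    rcases k with _ | k
    · have h0 := D_zero hF
      simp [pow_succ, h0]
    · rw [ih k _ (D_mem hF)]
      have e1 : ((D m).toLinearMap ^ (s+1)) F = ((D m).toLinearMap ^ s) (D m F) := by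
        rw [pow_succ, Module.End.mul_apply, Derivation.coeFn_coe]
      rw [Module.End.mul_apply, Derivation.coeFn_coe, e1]
      push_cast
      module

lemma D_pow_zero {m l : ℕ} : ∀ (k : ℕ) (F : MvPolynomial (Fin (m+1)) ℝ), F ∈ W m l k →
    ((D m).toLinearMap ^ (k+1)) F = 0 := by
  intro k
  induction k with
  | zero => intro F hF; simpa using D_zero hF
  | succ k ih =>
    intro F hF
    rw [pow_succ, Module.End.mul_apply, Derivation.coeFn_coe]
    exact ih _ (D_mem hF)

lemma D_surj_aux {m l k : ℕ} (hk : 2 * k < l * m) (r : ℕ) :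
    ∀ F : MvPolynomial (Fin (m+1)) ℝ, F ∈ W m l k → ((D m).toLinearMap ^ r) F = 0 →
    ∃ G ∈ W m l (k+1), D m G = F := by
  have hk' : (2 : ℝ) * k < l * m := by exact_mod_cast hk
  induction r with
  | zero =>
    intro F hF h
    refine ⟨0, Submodule.zero_mem _, ?_⟩
    simpa using h.symm
  | succ r ih =>
    intro F hF h
    set c : ℝ := ((r : ℝ) + 1) * ((l : ℝ) * m - 2 * k + r) with hc
    have hc0 : c ≠ 0 := by
      have : 0 < (l : ℝ) * m - 2 * k + r := by
        have : (0 : ℝ) ≤ r := Nat.cast_nonneg r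
        linarith
      positivity
    have h1 := DU_pow r k F hF
    rw [h, map_zero, zero_add] at h1
    obtain ⟨G, hG, hG'⟩ := ih (D m (U m F) - c • F)
      (Submodule.sub_mem _ (D_mem (U_mem hF)) (Submodule.smul_mem _ _ hF)) (by
        rw [map_sub, map_smul, ← hc] at *
        rw [← h1, pow_succ, Module.End.mul_apply, Derivation.coeFn_coe, sub_self])
    refine ⟨c⁻¹ • (U m F - G), Submodule.smul_mem _ _ (Submodule.sub_mem _ (U_mem hF) hG), ?_⟩
    rw [Derivation.map_smul, map_sub, hG', sub_sub_cancel, smul_smul, inv_mul_cancel₀ hc0, one_smul]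

lemma D_surj {m l k : ℕ} (hk : 2 * k < l * m) {F : MvPolynomial (Fin (m+1)) ℝ} (hF : F ∈ W m l k) :
    ∃ G ∈ W m l (k+1), D m G = F :=
  D_surj_aux hk (k+1) F hF (D_pow_zero k F hF)

lemma U_pow_mem {m l k : ℕ} {F : MvPolynomial (Fin (m+1)) ℝ} (hF : F ∈ W m l k) (s : ℕ) :
    ((U m).toLinearMap ^ s) F ∈ W m l (k+s) := by
  induction s with
  | zero => simpa using hF
  | succ s ih =>
    rw [pow_succ', Module.End.mul_apply, Derivation.coeFn_coe]
    exact U_mem ih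

lemma D_U_pow {m l k : ℕ} {F : MvPolynomial (Fin (m+1)) ℝ} (hF : F ∈ W m l k) (h0 : D m F = 0)
    (s : ℕ) : D m (((U m).toLinearMap ^ (s+1)) F) =
      (((s : ℝ) + 1) * ((l : ℝ) * m - 2 * k - s)) • ((U m).toLinearMap ^ s) F := by
  induction s with
  | zero => simpa [h0] using H_eigen hF
  | succ s ih =>
    rw [pow_succ', Module.End.mul_apply, Derivation.coeFn_coe, H_eigen (U_pow_mem hF (s+1)), ih,
      Derivation.map_smul]
    have : U m (((U m).toLinearMap ^ s) F) = ((U m).toLinearMap ^ (s+1)) F := by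
      rw [pow_succ', Module.End.mul_apply, Derivation.coeFn_coe]
    rw [this]
    push_cast
    module

lemma D_inj {m l k : ℕ} (hk : l * m < 2 * k) {F : MvPolynomial (Fin (m+1)) ℝ} (hF : F ∈ W m l k)
    (h0 : D m F = 0) : F = 0 := by
  have hk' : (l : ℝ) * m < 2 * k := by exact_mod_cast hk
  have key : ∀ s : ℕ, ((U m).toLinearMap ^ s) F = 0 → F = 0 := by
    intro s
    induction s with
    | zero => intro h; simpa using h
    | succ s ih =>
      intro h
      apply ih
      have h1 := D_U_pow hF h0 s
      rw [h, map_zero] at h1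
      have hc : ((s : ℝ) + 1) * ((l : ℝ) * m - 2 * k - s) ≠ 0 := by
        have hs : (0 : ℝ) ≤ s := Nat.cast_nonneg s
        apply mul_ne_zero <;> linarith
      exact (smul_eq_zero.mp h1.symm).resolve_left hc
  exact key (l * m + 1) (W_bot (by omega) (U_pow_mem hF (l * m + 1)))

lemma U_pow_top {m l k x : ℕ} (hx : 2 * k + x = l * m) {F : MvPolynomial (Fin (m+1)) ℝ}
    (hF : F ∈ W m l k) (h0 : D m F = 0) : ((U m).toLinearMap ^ (x+1)) F = 0 := by
  refine D_inj (k := k + (x+1)) (by omega) (U_pow_mem hF (x+1)) ?_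
  rw [D_U_pow hF h0]
  have : (2 : ℝ) * k + x = l * m := by exact_mod_cast hx
  rw [show (l : ℝ) * m - 2 * k - x = 0 by linarith]
  simp

/-- index set -/
def idx (m l k : ℕ) : Set (Fin (m+1) →₀ ℕ) := {d | Finsupp.weight (wt m) d = (l, k)}

lemma idx_finite (m l k : ℕ) : (idx m l k).Finite := by
  refine Set.Finite.subset (Finset.finite_toSet (Finset.finsuppAntidiag Finset.univ l)) ?_
  intro d hd
  have : Finsupp.weight (wt m) d = (l, k) := hd
  rw [wt_weight, Prod.mk.injEq] at this
  simp [this.1]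

noncomputable def Wequiv (m l k : ℕ) : W m l k ≃ₗ[ℝ] (idx m l k →₀ ℝ) :=
  (LinearEquiv.ofEq _ _ (weightedHomogeneousSubmodule_eq_finsupp_supported ℝ (wt m) (l, k))).trans
    (basisRestrictSupport ℝ (idx m l k)).repr

instance (m l k : ℕ) : Finite (idx m l k) := idx_finite m l k

instance (m l k : ℕ) : FiniteDimensional ℝ (W m l k) :=
  Module.Finite.equiv (Wequiv m l k).symm

lemma finrank_W (m l k : ℕ) : Module.finrank ℝ (W m l k) = Nat.card (idx m l k) := by
  have := Fintype.ofFinite (idx m l k)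
  rw [(Wequiv m l k).finrank_eq, Module.finrank_finsupp_self, Nat.card_eq_fintype_card]

noncomputable def Kr (m l k : ℕ) : Submodule ℝ (MvPolynomial (Fin (m+1)) ℝ) :=
  W m l k ⊓ LinearMap.ker (D m).toLinearMap

lemma mem_Kr {m l k : ℕ} {F : MvPolynomial (Fin (m+1)) ℝ} : F ∈ Kr m l k ↔ F ∈ W m l k ∧ D m F = 0 := by
  rw [Kr, Submodule.mem_inf, LinearMap.mem_ker]; rfl

instance (m l k : ℕ) : FiniteDimensional ℝ (Kr m l k) :=
  Submodule.finiteDimensional_of_le (inf_le_left : Kr m l k ≤ W m l k)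

lemma Kr_zero (m l : ℕ) : Kr m l 0 = W m l 0 := by
  ext F
  rw [mem_Kr]
  exact ⟨fun h => h.1, fun h => ⟨h, D_zero h⟩⟩

noncomputable def Dr (m l k : ℕ) : W m l (k+1) →ₗ[ℝ] W m l k :=
  (D m).toLinearMap.restrict (fun _ h => D_mem h)

lemma finrank_Kr {m l k : ℕ} (hk : 2 * k < l * m) :
    Module.finrank ℝ (Kr m l (k+1)) + Nat.card (idx m l k) = Nat.card (idx m l (k+1)) := by
  rw [← finrank_W, ← finrank_W]
  have h := LinearMap.finrank_range_add_finrank_ker (Dr m l k)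
  have hs : Function.Surjective (Dr m l k) := by
    rintro ⟨F, hF⟩
    obtain ⟨G, hG, hG'⟩ := D_surj hk hF
    exact ⟨⟨G, hG⟩, Subtype.ext hG'⟩
  rw [LinearMap.range_eq_top.mpr hs, finrank_top] at h
  have e : Module.finrank ℝ (LinearMap.ker (Dr m l k)) = Module.finrank ℝ (Kr m l (k+1)) := by
    have : Kr m l (k+1) = (LinearMap.ker (Dr m l k)).map (W m l (k+1)).subtype := by
      ext F
      rw [mem_Kr, Submodule.mem_map]
      constructor
      · rintro ⟨h1, h2⟩
        exact ⟨⟨F, h1⟩, by rw [LinearMap.mem_ker]; exact Subtype.ext h2, rfl⟩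
      · rintro ⟨⟨G, hG⟩, h1, rfl⟩
        rw [LinearMap.mem_ker] at h1
        exact ⟨hG, congrArg Subtype.val h1⟩
    rw [this]
    exact (LinearEquiv.finrank_eq (Submodule.equivMapOfInjective _ (Submodule.subtype_injective _) _))
  omega

lemma card_le_of_gt {m l k : ℕ} (hk : l * m < 2 * (k+1)) :
    Nat.card (idx m l (k+1)) ≤ Nat.card (idx m l k) := by
  rw [← finrank_W, ← finrank_W]
  apply LinearMap.finrank_le_finrank_of_injective (f := Dr m l k)
  rw [← LinearMap.ker_eq_bot, LinearMap.ker_eq_bot']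
  rintro ⟨F, hF⟩ h
  exact Subtype.ext (D_inj hk hF (congrArg Subtype.val h))

lemma Kr_mul {m l l' k k' : ℕ} {F : MvPolynomial (Fin (m+1)) ℝ} (hF : F ∈ Kr m l' k') (h0 : F ≠ 0) :
    Module.finrank ℝ (Kr m l k) ≤ Module.finrank ℝ (Kr m (l+l') (k+k')) := by
  have hm : ∀ G ∈ Kr m l k, LinearMap.mulRight ℝ F G ∈ Kr m (l+l') (k+k') := by
    intro G hG
    rw [mem_Kr] at hF hG ⊢
    constructor
    · exact IsWeightedHomogeneous.mul (w := wt m) (m := (l,k)) (n := (l',k')) hG.1 hF.1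
    · simp [LinearMap.mulRight_apply, Derivation.leibniz, hF.2, hG.2]
  apply LinearMap.finrank_le_finrank_of_injective
    (f := (LinearMap.mulRight ℝ F).restrict hm)
  intro G G' h
  have := congrArg Subtype.val h
  exact Subtype.ext (mul_right_cancel₀ h0 this)

end QB

end

section
open MvPolynomial

namespace QB

/-- the real structure -/
noncomputable def tau (m : ℕ) : MvPolynomial (Fin (m+1)) ℝ →ₐ[ℝ] MvPolynomial (Fin (m+1)) ℝ :=
  aeval (fun i : Fin (m+1) => ((-1 : ℝ) ^ (i : ℕ)) • X (Fin.rev i))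

lemma tau_mem {m l k k' : ℕ} (h : k + k' = l * m) {F : MvPolynomial (Fin (m+1)) ℝ}
    (hF : F ∈ W m l k) : tau m F ∈ W m l k' := by
  refine W_le_of_monomial (tau m).toLinearMap _ (fun d hd => ?_) hF
  change tau m _ ∈ _
  rw [tau, aeval_monomial, map_one, one_mul, W, mem_weightedHomogeneousSubmodule, Finsupp.prod_fintype _ _ (by simp)]
  have h1 := IsWeightedHomogeneous.prod (w := wt m) (R := ℝ) (Finset.univ : Finset (Fin (m+1)))
    (fun i => (((-1 : ℝ) ^ (i : ℕ)) • (X (Fin.rev i) : MvPolynomial (Fin (m+1)) ℝ)) ^ (d i))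
    (fun i => d i • wt m (Fin.rev i)) (fun i _ => by
      apply IsWeightedHomogeneous.pow
      exact Submodule.smul_mem (weightedHomogeneousSubmodule ℝ (wt m) _) _
        (isWeightedHomogeneous_X ℝ (wt m) (Fin.rev i)))
  convert h1 using 1
  rw [wt_weight, Prod.mk.injEq] at hd
  have h2 : ∑ i : Fin (m+1), d i * ((Fin.rev i : Fin (m+1)) : ℕ) + ∑ i, d i * (i : ℕ) = l * m := by
    rw [← hd.1, Finset.sum_mul, ← Finset.sum_add_distrib]
    refine Finset.sum_congr rfl fun i _ => ?_
    rw [← mul_add, Fin.val_rev]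
    congr 1
    omega
  ext
  · simp [wt, Prod.fst_sum, hd.1]
  · simp only [wt, Prod.snd_sum, Prod.smul_snd, smul_eq_mul]
    omega

lemma D_tau (m : ℕ) (F : MvPolynomial (Fin (m+1)) ℝ) : D m (tau m F) = - tau m (U m F) := by
  induction F using MvPolynomial.induction_on with
  | C a => simp [tau]
  | add p q hp hq => simp only [map_add, hp, hq]; ring
  | mul_X p i hp =>
    rw [map_mul, Derivation.leibniz, Derivation.leibniz, map_add, smul_eq_mul, smul_eq_mul,
      smul_eq_mul, smul_eq_mul, map_mul, map_mul, hp]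
    have hX : D m (tau m (X i)) = - tau m (U m (X i)) := by
      rw [U, mkDerivation_X, tau, aeval_X, Derivation.map_smul, D, mkDerivation_X, map_smul, aeval_X]
      simp only [Fin.val_rev]
      by_cases hi : (i : ℕ) = m
      · have hr : ((i : ℕ) : ℝ) = m := by rw [hi]
        have hr2 : ((m + 1 - ((i : ℕ) + 1) : ℕ) : ℝ) = 0 := by rw [hi]; simp
        rw [hr, hr2]; simp
      · have e1 : ((m + 1 - ((i : ℕ) + 1) : ℕ) : ℝ) = m - (i : ℕ) := by
          rw [Nat.cast_sub (by omega)]; push_cast; ring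
        have e2 : (⟨m + 1 - ((i : ℕ) + 1) - 1, by omega⟩ : Fin (m+1)) =
            Fin.rev ⟨min ((i : ℕ) + 1) m, by omega⟩ := by
          ext; simp [Fin.val_rev]; omega
        have e3 : min ((i : ℕ) + 1) m = (i : ℕ) + 1 := by omega
        rw [e1, e2]
        simp only [e3, pow_succ]
        module
    rw [hX]; ring

/-- real points -/
def RealPt (m : ℕ) (v : Fin (m+1) → ℂ) : Prop :=
  ∀ i, v (Fin.rev i) = (-1) ^ (i : ℕ) * (starRingEnd ℂ) (v i)

lemma aeval_tau {m : ℕ} {v : Fin (m+1) → ℂ} (hv : RealPt m v) (F : MvPolynomial (Fin (m+1)) ℝ) :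
    aeval v (tau m F) = (starRingEnd ℂ) (aeval v F) := by
  have : (aeval v).comp (tau m) = (Complex.conjAe.toAlgHom).comp (aeval v : MvPolynomial (Fin (m+1)) ℝ →ₐ[ℝ] ℂ) := by
    apply algHom_ext
    intro i
    simp only [AlgHom.comp_apply, tau, aeval_X, map_smul]
    rw [hv i]
    have : ((-1 : ℝ) ^ (i : ℕ)) • ((-1 : ℂ) ^ (i : ℕ) * (starRingEnd ℂ) (v i)) = (starRingEnd ℂ) (v i) := by
      rw [Complex.real_smul]
      push_cast
      rw [← mul_assoc, ← mul_pow]; simp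
    rw [this]; simp
  exact DFunLike.congr_fun this F

lemma real_dense {m : ℕ} (hm : Even m) (F : MvPolynomial (Fin (m+1)) ℝ)
    (h : ∀ v, RealPt m v → aeval v F = 0) : F = 0 := by
  apply MvPolynomial.funext
  intro w
  set u : Fin (m+1) → ℂ := fun i => ((w i : ℂ) + (-1) ^ (i : ℕ) * (w (Fin.rev i) : ℂ)) / 2 with hu
  set u' : Fin (m+1) → ℂ := fun i => ((w i : ℂ) - (-1) ^ (i : ℕ) * (w (Fin.rev i) : ℂ)) / 2 * (-Complex.I) with hu'
  have hsign : ∀ i : Fin (m+1), (-1 : ℂ) ^ ((Fin.rev i : Fin (m+1)) : ℕ) = (-1) ^ (i : ℕ) := by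
    intro i
    apply neg_one_pow_congr
    rw [Fin.val_rev]
    have := i.2
    have e : m + 1 - ((i : ℕ) + 1) = m - i := by omega
    rw [e, Nat.even_sub (by omega)]
    simp [hm]
  have hsq : ∀ i : Fin (m+1), (-1 : ℂ) ^ (i : ℕ) * (-1 : ℂ) ^ (i : ℕ) = 1 := by
    intro i; rw [← mul_pow]; simp
  have hru : RealPt m u := by
    intro i
    simp only [hu, hsign, Fin.rev_rev, map_div₀, map_add, map_mul, map_pow, map_neg, map_one,
      Complex.conj_ofReal, map_ofNat]
    linear_combination (-(w (Fin.rev i) : ℂ) / 2) * hsq i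
  have hru' : RealPt m u' := by
    intro i
    simp only [hu', hsign, Fin.rev_rev, map_div₀, map_sub, map_mul, map_pow, map_neg, map_one,
      Complex.conj_ofReal, map_ofNat, Complex.conj_I]
    linear_combination ((w (Fin.rev i) : ℂ) / 2) * Complex.I * hsq i
  set f : Polynomial ℂ := aeval (fun i => Polynomial.C (u i) + Polynomial.X * Polynomial.C (u' i)) F with hf
  have hfe : ∀ z : ℂ, f.eval z = aeval (fun i => u i + z * u' i) F := by
    intro z
    have : ((Polynomial.aeval z : Polynomial ℂ →ₐ[ℂ] ℂ).restrictScalars ℝ).comp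
        (aeval (fun i => Polynomial.C (u i) + Polynomial.X * Polynomial.C (u' i))) =
        (aeval (fun i => u i + z * u' i) : MvPolynomial (Fin (m+1)) ℝ →ₐ[ℝ] ℂ) := by
      apply algHom_ext
      intro i
      simp
      ring
    have h2 := DFunLike.congr_fun this F
    rw [← h2, hf]
    simp
  have hf0 : f = 0 := by
    apply Polynomial.eq_zero_of_infinite_isRoot
    refine Set.Infinite.mono ?_ (Set.infinite_range_of_injective Complex.ofReal_injective)
    rintro _ ⟨t, rfl⟩
    change f.eval (t : ℂ) = 0
    rw [hfe]
    apply h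
    intro i
    change u (Fin.rev i) + t * u' (Fin.rev i) = (-1)^(i:ℕ) * starRingEnd ℂ (u i + t * u' i)
    rw [hru i, hru' i]
    simp only [map_add, map_mul, Complex.conj_ofReal]
    ring
  have h1 := hfe Complex.I
  rw [hf0, Polynomial.eval_zero] at h1
  have h2 : (fun i => u i + Complex.I * u' i) = fun i => (algebraMap ℝ ℂ) (w i) := by
    funext i
    simp only [hu, hu', Complex.coe_algebraMap]
    linear_combination (-((w i : ℂ) - (-1) ^ (i : ℕ) * (w (Fin.rev i) : ℂ)) / 2) * Complex.I_mul_I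
  rw [h2] at h1
  have h3 : aeval (fun i => (algebraMap ℝ ℂ) (w i)) F = algebraMap ℝ ℂ (eval w F) := by
    have : (aeval (fun i => (algebraMap ℝ ℂ) (w i)) : MvPolynomial (Fin (m+1)) ℝ →ₐ[ℝ] ℂ) =
        (Algebra.ofId ℝ ℂ).comp (aeval w) := by
      apply algHom_ext
      intro i
      simp [Algebra.ofId_apply]
    rw [this, AlgHom.comp_apply, Algebra.ofId_apply, aeval_eq_eval]
  rw [h3] at h1
  simpa using h1.symm

lemma sep_points {m : ℕ} (hm : Even m) (n : ℕ) : ∀ E : Submodule ℝ (MvPolynomial (Fin (m+1)) ℝ),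
    FiniteDimensional ℝ E → Module.finrank ℝ E ≤ n →
    ∃ v : Fin n → (Fin (m+1) → ℂ), (∀ i, RealPt m (v i)) ∧
      ∀ F ∈ E, (∀ i, aeval (v i) F = 0) → F = 0 := by
  induction n with
  | zero =>
    intro E hE hn
    refine ⟨fun i => i.elim0, fun i => i.elim0, fun F hF _ => ?_⟩
    have := Submodule.finrank_eq_zero.mp (Nat.le_zero.mp hn)
    rw [this] at hF
    exact (Submodule.mem_bot ℝ).mp hF
  | succ n ih =>
    intro E hE hn
    by_cases hb : E = ⊥
    · refine ⟨fun _ _ => 0, fun i j => by simp, fun F hF _ => ?_⟩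
      rw [hb] at hF
      exact (Submodule.mem_bot ℝ).mp hF
    · obtain ⟨F0, hF0, hne⟩ := Submodule.exists_mem_ne_zero_of_ne_bot hb
      have : ∃ v0, RealPt m v0 ∧ aeval v0 F0 ≠ 0 := by
        by_contra hcon
        push Not at hcon
        exact hne (real_dense hm F0 hcon)
      obtain ⟨v0, hv0, hv0'⟩ := this
      set E' := E ⊓ LinearMap.ker (aeval v0 : MvPolynomial (Fin (m+1)) ℝ →ₐ[ℝ] ℂ).toLinearMap with hE'
      have hlt : E' < E := by
        refine lt_of_le_of_ne inf_le_left fun he => ?_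
        rw [← he] at hF0
        exact hv0' (LinearMap.mem_ker.mp hF0.2)
      have hfd : FiniteDimensional ℝ E' := Submodule.finiteDimensional_of_le hlt.le
      obtain ⟨v, hv, hsep⟩ := ih E' hfd (by
        have := Submodule.finrank_lt_finrank_of_lt hlt
        omega)
      refine ⟨Fin.cons v0 v, fun i => ?_, fun F hF h => ?_⟩
      · refine Fin.cases ?_ (fun i => ?_) i
        · simpa using hv0
        · simpa using hv i
      · apply hsep F
        · refine ⟨hF, LinearMap.mem_ker.mpr ?_⟩
          simpa using h 0
        · intro i
          simpa using h i.succ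

/-- coefficient -/
noncomputable def cf (x j : ℕ) : ℝ := ((x - j).factorial : ℝ) / (j.factorial : ℝ)

/-- the invariant -/
noncomputable def PP (m x : ℕ) (h : MvPolynomial (Fin (m+1)) ℝ) : MvPolynomial (Fin (m+1)) ℝ :=
  ∑ j ∈ Finset.range (x+1), cf x j • (((U m).toLinearMap ^ j) h * tau m (((U m).toLinearMap ^ j) h))

lemma PP_mem {m l k x : ℕ} (hx : 2 * k + x = l * m) {h : MvPolynomial (Fin (m+1)) ℝ}
    (hh : h ∈ Kr m l k) : PP m x h ∈ Kr m (l+l) (l*m) := by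
  rw [mem_Kr] at hh ⊢
  constructor
  · refine Submodule.sum_mem _ fun j hj => Submodule.smul_mem _ _ ?_
    have hj' : j ≤ x := by simpa [Nat.lt_succ_iff] using hj
    have h1 := U_pow_mem hh.1 j
    have h2 := tau_mem (k' := l * m - (k+j)) (by omega) h1
    have := IsWeightedHomogeneous.mul (w := wt m) (m := (l,k+j)) (n := (l,l * m - (k+j))) h1 h2
    rw [W, mem_weightedHomogeneousSubmodule]
    convert this using 1
    ext
    · simp
    · simp; omega
  · have key : ∀ n ≤ x, D m (∑ j ∈ Finset.range (n+1), cf x j • (((U m).toLinearMap ^ j) h * tau m (((U m).toLinearMap ^ j) h)))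
        = - (cf x n • (((U m).toLinearMap ^ n) h * tau m (((U m).toLinearMap ^ (n+1)) h))) := by
      have hU : ∀ n, U m (((U m).toLinearMap ^ n) h) = ((U m).toLinearMap ^ (n+1)) h := by
        intro n
        rw [pow_succ', Module.End.mul_apply, Derivation.coeFn_coe]
      intro n
      induction n with
      | zero =>
        intro _
        have := hU 0
        simp only [pow_zero, Module.End.one_apply] at this
        rw [zero_add, Finset.sum_range_one, Derivation.map_smul, Derivation.leibniz, D_tau, pow_zero,
          Module.End.one_apply, this, hh.2, smul_zero, add_zero, smul_eq_mul, mul_neg, smul_neg, zero_add]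
      | succ n ih =>
        intro hn
        rw [Finset.sum_range_succ, map_add, ih (by omega), Derivation.map_smul, Derivation.leibniz,
          D_tau, hU, D_U_pow hh.1 hh.2]
        have hx' : (2 : ℝ) * k + x = l * m := by exact_mod_cast hx
        have hc : cf x n = cf x (n+1) * (((n : ℝ) + 1) * ((l : ℝ) * m - 2 * k - n)) := by
          rw [← hx', cf, cf]
          have e1 : x - n = (x - (n+1)) + 1 := by omega
          rw [e1, Nat.factorial_succ, Nat.factorial_succ]
          have : ((x - (n+1) : ℕ) : ℝ) = x - (n+1) := by
            rw [Nat.cast_sub hn]; simp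
          have h3 : (n.factorial : ℝ) ≠ 0 := by positivity
          push_cast
          rw [this]
          field_simp
          ring
        rw [hc]
        simp only [smul_eq_mul, smul_add, mul_neg, smul_neg, mul_smul_comm, smul_smul]
        rw [mul_comm (tau m _) (((U m).toLinearMap ^ n) h)]
        abel
    have h1 := key x le_rfl
    rw [U_pow_top hx hh.1 hh.2] at h1
    simpa [PP] using h1

lemma aeval_PP {m x : ℕ} {v : Fin (m+1) → ℂ} (hv : RealPt m v) (h : MvPolynomial (Fin (m+1)) ℝ) :
    aeval v (PP m x h) = ((∑ j ∈ Finset.range (x+1),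
      cf x j * Complex.normSq (aeval v (((U m).toLinearMap ^ j) h)) : ℝ) : ℂ) := by
  rw [PP, map_sum]
  push_cast
  refine Finset.sum_congr rfl fun j _ => ?_
  rw [map_smul, map_mul, aeval_tau hv, Complex.mul_conj, Complex.real_smul]

lemma pos_bound {m l k x : ℕ} (hm : Even m) (hx : 2 * k + x = l * m) :
    Module.finrank ℝ (Kr m l k) ≤ 2 * (x+1) * Module.finrank ℝ (Kr m (l+l) (l*m)) := by
  set J := Module.finrank ℝ (Kr m (l+l) (l*m)) with hJ
  obtain ⟨v, hv, hsep⟩ := sep_points hm J (Kr m (l+l) (l*m)) inferInstance le_rfl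
  let Φ : Kr m l k →ₗ[ℝ] (Fin J × Fin (x+1) → ℂ) :=
    LinearMap.pi (fun ij => (aeval (v ij.1) : MvPolynomial (Fin (m+1)) ℝ →ₐ[ℝ] ℂ).toLinearMap ∘ₗ
      ((U m).toLinearMap ^ (ij.2 : ℕ)) ∘ₗ (Kr m l k).subtype)
  have hinj : Function.Injective Φ := by
    rw [← LinearMap.ker_eq_bot, LinearMap.ker_eq_bot']
    rintro ⟨h, hh⟩ h0
    have h1 : ∀ i : Fin J, ∀ j : Fin (x+1), aeval (v i) (((U m).toLinearMap ^ (j : ℕ)) h) = 0 := by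
      intro i j
      exact congrFun h0 (i, j)
    have hP : PP m x h = 0 := by
      apply hsep _ (PP_mem hx hh)
      intro i
      rw [aeval_PP (hv i), Finset.sum_eq_zero]
      · simp
      · intro j hj
        rw [h1 i ⟨j, by simpa using hj⟩]; simp
    apply Subtype.ext
    apply real_dense hm
    intro w hw
    have h2 := aeval_PP (x := x) hw h
    rw [hP, map_zero] at h2
    have h3 := Complex.ofReal_eq_zero.mp h2.symm
    rw [Finset.sum_eq_zero_iff_of_nonneg] at h3
    · have h4 := h3 0 (by simp)
      have hc : cf x 0 ≠ 0 := by
        rw [cf]; positivity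
      simpa [hc] using h4
    · intro j _
      have : 0 ≤ cf x j := by rw [cf]; positivity
      exact mul_nonneg this (Complex.normSq_nonneg _)
  have := LinearMap.finrank_le_finrank_of_injective hinj
  rw [Module.finrank_pi_fintype] at this
  simp [Complex.finrank_real_complex] at this
  calc _ ≤ _ := this
    _ = _ := by ring

end QB

end

section

open Polynomial

namespace QB

/-- gaussian binomials -/
noncomputable def G : ℕ → ℕ → ℤ[X]
  | 0, _ => 1
  | _+1, 0 => 1
  | m+1, l+1 => G m (l+1) + X ^ (m+1) * G (m+1) l

lemma G_zero_left (l : ℕ) : G 0 l = 1 := by rw [G]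
lemma G_zero_right (m : ℕ) : G m 0 = 1 := by cases m <;> rw [G]
lemma G_A (m l : ℕ) : G (m+1) (l+1) = G m (l+1) + X ^ (m+1) * G (m+1) l := by rw [G]

noncomputable def Pq (n : ℕ) : ℤ[X] := ∏ i ∈ Finset.range n, (1 - X ^ (i+1))

lemma Pq_succ (n : ℕ) : Pq (n+1) = Pq n * (1 - X ^ (n+1)) := by
  rw [Pq, Finset.prod_range_succ]; rfl

lemma Pq_ne (n : ℕ) : Pq n ≠ 0 := by
  rw [Pq, Finset.prod_ne_zero_iff]
  intro i _ h
  have := congrArg (Polynomial.eval 0) h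
  simp at this

lemma G_prod (m : ℕ) : ∀ l, G m l * (Pq m * Pq l) = Pq (m + l) := by
  induction m with
  | zero => intro l; rw [G_zero_left]; simp [Pq]
  | succ m ihm =>
    intro l
    induction l with
    | zero => rw [G_zero_right]; simp [Pq]
    | succ l ihl =>
      have h1 := ihm (l+1)
      rw [G_A, show m + 1 + (l + 1) = (m + l + 1) + 1 by ring, Pq_succ (m+l+1)]
      rw [show m + (l+1) = m + l + 1 by ring] at h1
      rw [show m + 1 + l = m + l + 1 by ring] at ihl
      have e1 := Pq_succ m
      have e2 := Pq_succ l
      rw [e1] at ihl ⊢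
      rw [e2] at h1 ⊢
      linear_combination (1 - X ^ (m+1)) * h1 + X ^ (m+1) * (1 - X ^ (l+1)) * ihl

lemma G_symm (m l : ℕ) : G m l = G l m := by
  have h : Pq m * Pq l ≠ 0 := mul_ne_zero (Pq_ne m) (Pq_ne l)
  apply mul_right_cancel₀ h
  rw [G_prod, mul_comm (Pq m), G_prod, add_comm]

lemma G_B (m l : ℕ) : G (m+1) (l+1) = G (m+1) l + X ^ (l+1) * G m (l+1) := by
  rw [G_symm, G_A, G_symm l, G_symm (l+1) m]

lemma G_eval (m : ℕ) : ∀ l, (G m l).eval 1 = ((m+l).choose l : ℤ) := by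
  induction m with
  | zero => intro l; rw [G_zero_left]; simp
  | succ m ihm =>
    intro l
    induction l with
    | zero => rw [G_zero_right]; simp
    | succ l ihl =>
      rw [G_A, eval_add, eval_mul, ihm, ihl, show m + 1 + (l + 1) = (m + 1 + l) + 1 by ring,
        Nat.choose_succ_succ, show m + (l+1) = m + 1 + l by ring]
      simp; ring

/-! idx counts -/

lemma mem_idx {m l k : ℕ} {d : Fin (m+1) →₀ ℕ} :
    d ∈ idx m l k ↔ ∑ i, d i = l ∧ ∑ i, d i * (i : ℕ) = k := by
  rw [idx, Set.mem_ofPred_eq, wt_weight, Prod.mk.injEq]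

lemma mem_idx_succ {m l k : ℕ} {d : Fin (m+1+1) →₀ ℕ} :
    d ∈ idx (m+1) l k ↔ d 0 + ∑ i : Fin (m+1), d i.succ = l ∧
      ∑ i : Fin (m+1), d i.succ * (i : ℕ) + ∑ i : Fin (m+1), d i.succ = k := by
  rw [mem_idx, Fin.sum_univ_succ (fun i => d i), Fin.sum_univ_succ (fun i => d i * (i : ℕ)),
    ← Finset.sum_add_distrib]
  simp only [Fin.val_zero, mul_zero, zero_add, Fin.val_succ, mul_add, mul_one]

lemma card_zero_left (l k : ℕ) : (idx 0 l k).ncard = if k = 0 then 1 else 0 := by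
  split_ifs with h
  · subst h
    rw [Set.ncard_eq_one]
    refine ⟨Finsupp.single 0 l, ?_⟩
    ext d
    rw [mem_idx]
    simp only [Nat.reduceAdd, Finset.univ_unique, Fin.default_eq_zero, Finset.sum_singleton, Set.mem_singleton_iff]
    constructor
    · rintro ⟨h, _⟩
      ext i
      rw [Fin.fin_one_eq_zero i, h]; simp
    · rintro rfl
      simp
  · rw [Set.ncard_eq_zero (idx_finite 0 l k)]
    ext d
    rw [mem_idx]
    simp
    omega

lemma card_zero_right (m k : ℕ) : (idx m 0 k).ncard = if k = 0 then 1 else 0 := by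
  split_ifs with h
  · subst h
    rw [Set.ncard_eq_one]
    refine ⟨0, ?_⟩
    ext d
    rw [mem_idx]
    simp only [Set.mem_singleton_iff]
    constructor
    · rintro ⟨h, _⟩
      ext i
      simpa using (Finset.sum_eq_zero_iff.mp h) i (Finset.mem_univ i)
    · rintro rfl
      simp
  · rw [Set.ncard_eq_zero (idx_finite m 0 k)]
    ext d
    rw [mem_idx]
    simp only [Set.mem_empty_iff_false, iff_false]
    rintro ⟨h1, h2⟩
    apply h
    rw [← h2]
    apply Finset.sum_eq_zero
    intro i hi
    rw [(Finset.sum_eq_zero_iff.mp h1) i hi, zero_mul]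

lemma card_succ (m l k : ℕ) : (idx (m+1) (l+1) k).ncard =
    (idx (m+1) l k).ncard + if l + 1 ≤ k then (idx m (l+1) (k-(l+1))).ncard else 0 := by
  have h1 : idx (m+1) (l+1) k = (fun d => d + Finsupp.single 0 1) '' idx (m+1) l k ∪
      (Finsupp.cons 0) '' (if l + 1 ≤ k then idx m (l+1) (k-(l+1)) else ∅) := by
    ext d
    rw [mem_idx_succ, Set.mem_union, Set.mem_image, Set.mem_image]
    constructor
    · rintro ⟨ha, hb⟩
      by_cases h0 : d 0 = 0
      · right
        refine ⟨d.tail, ?_, ?_⟩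
        · rw [h0, zero_add] at ha
          rw [if_pos (by omega), mem_idx]
          refine ⟨ha, ?_⟩
          simp only [Finsupp.tail_apply]
          omega
        · rw [← h0, Finsupp.cons_tail]
      · left
        refine ⟨d - Finsupp.single 0 1, ?_, ?_⟩
        · rw [mem_idx_succ]
          simp only [Finsupp.tsub_apply, Finsupp.single_eq_same]
          simp only [ne_eq, Fin.succ_ne_zero, not_false_eq_true, Finsupp.single_eq_of_ne, tsub_zero]
          exact ⟨by omega, hb⟩
        · apply tsub_add_cancel_of_le
          rw [Finsupp.single_le_iff]; omega
    · rintro (⟨e, he, rfl⟩ | ⟨e, he, rfl⟩)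
      · rw [mem_idx_succ] at he
        simp only [Finsupp.add_apply, Finsupp.single_eq_same]
        simp only [ne_eq, Fin.succ_ne_zero, not_false_eq_true, Finsupp.single_eq_of_ne, add_zero]
        exact ⟨by omega, he.2⟩
      · split_ifs at he with hk
        · rw [mem_idx] at he
          simp only [Finsupp.cons_zero, Finsupp.cons_succ, he.1, he.2, zero_add, true_and]
          omega
        · exact absurd he (Set.notMem_empty _)
  have hfin : (if l + 1 ≤ k then idx m (l+1) (k-(l+1)) else ∅ : Set _).Finite := by
    split_ifs
    · exact idx_finite _ _ _
    · exact Set.finite_empty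
  rw [h1, Set.ncard_union_eq ?_ ((idx_finite _ _ _).image _) (hfin.image _),
    Set.ncard_image_of_injective _ (add_left_injective _), Set.ncard_image_of_injective]
  · split_ifs <;> simp
  · intro a b hab
    have := congrArg Finsupp.tail hab
    simpa using this
  · rw [Set.disjoint_left]
    rintro d ⟨e, _, rfl⟩ ⟨f, _, hf⟩
    have := DFunLike.congr_fun hf 0
    simp at this

lemma card_idx (m : ℕ) : ∀ l k, (Nat.card (idx m l k) : ℤ) = (G m l).coeff k := by
  induction m with
  | zero =>
    intro l k
    rw [Nat.card_coe_set_eq, card_zero_left, G_zero_left, coeff_one]; simp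
  | succ m ihm =>
    intro l
    induction l with
    | zero =>
      intro k
      rw [Nat.card_coe_set_eq, card_zero_right, G_zero_right, coeff_one]; simp
    | succ l ihl =>
      intro k
      rw [Nat.card_coe_set_eq, card_succ, G_B, coeff_add, coeff_X_pow_mul', ← ihl, ← ihm,
        Nat.card_coe_set_eq, Nat.card_coe_set_eq]
      split_ifs <;> simp

/-! partition counts -/

def S (k l m : ℕ) : Set (Multiset ℕ) :=
  {s | (∀ x ∈ s, 0 < x ∧ x ≤ m) ∧ s.sum = k ∧ s.card ≤ l}

lemma p_eq_S (k l m : ℕ) : p k l m = (S k l m).ncard := by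
  rw [p, ← Nat.card_eq_fintype_card, ← Nat.card_coe_set_eq]
  apply Nat.card_congr
  refine ⟨fun π => ⟨π.1.parts, fun x hx => ⟨π.1.parts_pos hx, π.2.2 x hx⟩, π.1.parts_sum, π.2.1⟩,
    fun s => ⟨⟨s.1, fun {x} hx => (s.2.1 x hx).1, s.2.2.1⟩, s.2.2.2, fun x hx => (s.2.1 x hx).2⟩, ?_, ?_⟩
  · intro π; rfl
  · intro s; rfl

lemma S_finite (k l m : ℕ) : (S k l m).Finite := by
  have : Finite (S k l m) := by
    refine Finite.of_injective (β := Nat.Partition k)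
      (fun s => ⟨s.1, fun {x} hx => (s.2.1 x hx).1, s.2.2.1⟩) ?_
    intro s t h
    apply Subtype.ext
    exact congrArg Nat.Partition.parts h
  exact this

lemma S_triv {k l m : ℕ} (h : l = 0 ∨ m = 0) : (S k l m).ncard = if k = 0 then 1 else 0 := by
  have h0 : ∀ s ∈ S k l m, s = 0 := by
    rintro s ⟨h1, h2, h3⟩
    rcases h with rfl | rfl
    · exact Multiset.card_eq_zero.mp (by omega)
    · apply Multiset.eq_zero_of_forall_notMem
      intro x hx
      have := h1 x hx
      omega
  split_ifs with hk
  · subst hk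
    rw [Set.ncard_eq_one]
    refine ⟨0, ?_⟩
    ext s
    refine ⟨h0 s, ?_⟩
    rintro rfl
    simp [S]
  · rw [Set.ncard_eq_zero (S_finite k l m)]
    ext s
    simp only [Set.mem_empty_iff_false, iff_false]
    intro hs
    have := h0 s hs
    subst this
    exact hk (by simpa using hs.2.1.symm)

lemma S_succ (m l k : ℕ) : (S k (l+1) (m+1)).ncard =
    (S k (l+1) m).ncard + if m + 1 ≤ k then (S (k-(m+1)) l (m+1)).ncard else 0 := by
  have h1 : S k (l+1) (m+1) = S k (l+1) m ∪
      (fun s => (m+1) ::ₘ s) '' (if m + 1 ≤ k then S (k-(m+1)) l (m+1) else ∅) := by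
    ext s
    rw [Set.mem_union, Set.mem_image]
    constructor
    · rintro ⟨ha, hb, hc⟩
      by_cases hm : (m+1) ∈ s
      · right
        obtain ⟨t, rfl⟩ := Multiset.exists_cons_of_mem hm
        refine ⟨t, ?_, rfl⟩
        rw [Multiset.sum_cons] at hb
        rw [Multiset.card_cons] at hc
        rw [if_pos (by omega)]
        exact ⟨fun x hx => ha x (Multiset.mem_cons_of_mem hx), by omega, by omega⟩
      · left
        refine ⟨fun x hx => ?_, hb, hc⟩
        have := ha x hx
        have h2 : x ≠ m + 1 := by rintro rfl; exact hm hx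
        omega
    · rintro (⟨ha, hb, hc⟩ | ⟨t, ht, rfl⟩)
      · refine ⟨fun x hx => ?_, hb, hc⟩
        have := ha x hx
        omega
      · split_ifs at ht with hk
        · obtain ⟨ha, hb, hc⟩ := ht
          refine ⟨fun x hx => ?_, ?_, ?_⟩
          · rcases Multiset.mem_cons.mp hx with rfl | hx
            · omega
            · exact ha x hx
          · rw [Multiset.sum_cons]; omega
          · rw [Multiset.card_cons]; omega
        · exact absurd ht (Set.notMem_empty _)
  have hfin : (if m + 1 ≤ k then S (k-(m+1)) l (m+1) else ∅ : Set _).Finite := by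
    split_ifs
    · exact S_finite _ _ _
    · exact Set.finite_empty
  rw [h1, Set.ncard_union_eq ?_ (S_finite _ _ _) (hfin.image _), Set.ncard_image_of_injective]
  · split_ifs <;> simp
  · intro a b hab
    exact (Multiset.cons_inj_right _).mp hab
  · rw [Set.disjoint_left]
    rintro s ⟨ha, _⟩ ⟨f, _, rfl⟩
    have := ha (m+1) (Multiset.mem_cons_self _ _)
    omega

lemma p_eq_G (m : ℕ) : ∀ l k, (p k l m : ℤ) = (G m l).coeff k := by
  simp only [p_eq_S]
  induction m with
  | zero =>
    intro l k
    rw [S_triv (Or.inr rfl), G_zero_left, coeff_one]; simp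
  | succ m ihm =>
    intro l
    induction l with
    | zero =>
      intro k
      rw [S_triv (Or.inl rfl), G_zero_right, coeff_one]; simp
    | succ l ihl =>
      intro k
      rw [S_succ, G_A, coeff_add, coeff_X_pow_mul', ← ihl, ← ihm]
      split_ifs <;> simp

lemma card_eq_p (m l k : ℕ) : Nat.card (idx m l k) = p k l m := by
  have := card_idx m l k
  rw [← p_eq_G] at this
  exact_mod_cast this

lemma p_symm (k l m : ℕ) : p k l m = p k m l := by
  have h1 := p_eq_G m l k
  rw [G_symm, ← p_eq_G] at h1
  exact_mod_cast h1

lemma p_big {k l m : ℕ} (h : l * m < k) : p k l m = 0 := by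
  rw [← card_eq_p, ← finrank_W]
  have : W m l k = ⊥ := by
    rw [eq_bot_iff]
    intro F hF
    exact (Submodule.mem_bot ℝ).mpr (W_bot h hF)
  rw [this]; simp

lemma p_total (l m : ℕ) : ∑ k ∈ Finset.range (l * m + 1), p k l m = (m + l).choose l := by
  have h1 := G_eval m l
  rw [Polynomial.eval_eq_sum_range' (n := l * m + 1)] at h1
  · simp only [one_pow, mul_one, ← p_eq_G] at h1
    exact_mod_cast h1
  · rw [Nat.lt_succ_iff, Polynomial.natDegree_le_iff_coeff_eq_zero]
    intro k hk
    rw [← p_eq_G, p_big hk]; rfl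

lemma p_zero (l m : ℕ) : p 0 l m = 1 := by
  have h : ∀ m l, (G m l).coeff 0 = 1 := by
    intro m
    induction m with
    | zero => intro l; rw [G_zero_left]; simp
    | succ m ih =>
      intro l
      cases l with
      | zero => rw [G_zero_right]; simp
      | succ l => rw [G_A, coeff_add, ih, coeff_X_pow_mul']; simp
  have := p_eq_G m l 0
  rw [h] at this
  exact_mod_cast this

end QB

end

section
namespace QB
def addL : List ℕ → List ℕ → List ℕ
  | [], b => b
  | x :: a, [] => x :: a
  | x :: a, y :: b => (x + y) :: addL a b
def shL : ℕ → List ℕ → List ℕ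
  | 0, a => a
  | n+1, a => 0 :: shL n a
def rowGo (n : ℕ) : List ℕ → List (List ℕ) → List (List ℕ)
  | _, [] => []
  | acc, r :: rs => addL r (shL n acc) :: rowGo n (addL r (shL n acc)) rs
def row : ℕ → List (List ℕ)
  | 0 => List.replicate 16 [1]
  | m+1 => [1] :: rowGo (m+1) [1] (row m).tail
def chkL : ℕ → List ℕ → Bool
  | 0, _ => true
  | _+1, [] => false
  | _+1, [_] => false
  | n+1, x :: y :: t => decide (x < y) && chkL n (y :: t)
def chkM (m : ℕ) : Bool :=
  (List.range 8).all fun i => chkL ((8+i) * m / 2 - 1) (((row m).getD (8+i) []).tail)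
lemma chk_all : (List.range 8).all (fun j => chkM (8+j)) = true := by decide +kernel

lemma addL_getD (a : List ℕ) : ∀ b k, (addL a b).getD k 0 = a.getD k 0 + b.getD k 0 := by
  induction a with
  | nil => intro b k; simp [addL]
  | cons x a ih =>
    intro b k
    cases b with
    | nil => simp [addL]
    | cons y b =>
      cases k with
      | zero => simp [addL]
      | succ k => simpa [addL] using ih b k

lemma shL_getD (n : ℕ) (a : List ℕ) : ∀ k, (shL n a).getD k 0 = if n ≤ k then a.getD (k-n) 0 else 0 := by
  induction n with
  | zero => intro k; simp [shL]
  | succ n ih =>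
    intro k
    cases k with
    | zero => simp [shL]
    | succ k =>
      have := ih k
      simp only [shL, List.getD_cons_succ, this, Nat.add_sub_add_right, Nat.add_le_add_iff_right]

def Rep (a : List ℕ) (m l : ℕ) : Prop := ∀ k, (a.getD k 0 : ℤ) = (G m l).coeff k

lemma rep_step {r acc : List ℕ} {m l : ℕ} (h1 : Rep r m (l+1)) (h2 : Rep acc (m+1) l) :
    Rep (addL r (shL (m+1) acc)) (m+1) (l+1) := by
  intro k
  rw [addL_getD, shL_getD, G_A, Polynomial.coeff_add, Polynomial.coeff_X_pow_mul', ← h1 k, ← h2]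
  split_ifs <;> simp

lemma rowGo_spec (m : ℕ) (rs : List (List ℕ)) : ∀ (acc : List ℕ) (l : ℕ), Rep acc (m+1) l →
    (∀ i < rs.length, Rep (rs.getD i []) m (l+1+i)) →
    (rowGo (m+1) acc rs).length = rs.length ∧
    ∀ i < rs.length, Rep ((rowGo (m+1) acc rs).getD i []) (m+1) (l+1+i) := by
  induction rs with
  | nil => intro acc l _ _; simp [rowGo]
  | cons r rs ih =>
    intro acc l hacc hrs
    have h0 : Rep r m (l+1) := by simpa using hrs 0 (by simp)
    have hs := rep_step h0 hacc
    obtain ⟨i1, i2⟩ := ih _ (l+1) hs (fun i hi => by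
      have := hrs (i+1) (by simpa using hi)
      rw [List.getD_cons_succ] at this
      convert this using 1
      ring)
    refine ⟨by simp [rowGo, i1], fun i hi => ?_⟩
    cases i with
    | zero => simpa [rowGo] using hs
    | succ i =>
      rw [rowGo, List.getD_cons_succ]
      have := i2 i (by simpa using hi)
      convert this using 1
      ring

lemma rep_one_left (l : ℕ) : Rep [1] 0 l := by
  intro k
  rw [G_zero_left, Polynomial.coeff_one]
  cases k <;> simp

lemma rep_one_right (m : ℕ) : Rep [1] m 0 := by
  intro k
  rw [G_zero_right, Polynomial.coeff_one]
  cases k <;> simp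

lemma row_spec (m : ℕ) : (row m).length = 16 ∧ ∀ l < 16, Rep ((row m).getD l []) m l := by
  induction m with
  | zero =>
    refine ⟨by simp [row], fun l hl => ?_⟩
    have : (row 0).getD l [] = [1] := by
      rw [row, List.getD_replicate _ hl]
    rw [this]
    exact rep_one_left l
  | succ m ih =>
    obtain ⟨i1, i2⟩ := ih
    have ht : (row m).tail.length = 15 := by simp [i1]
    obtain ⟨j1, j2⟩ := rowGo_spec m (row m).tail [1] 0 (rep_one_right _) (fun i hi => by
      have h3 := i2 (i+1) (by omega)
      have : (row m).tail.getD i [] = (row m).getD (i+1) [] := by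
        cases hr : row m with
        | nil => simp
        | cons a b => simp
      rw [this]
      convert h3 using 1
      ring)
    refine ⟨by rw [row, List.length_cons, j1, ht], fun l hl => ?_⟩
    cases l with
    | zero => simpa [row] using rep_one_right (m+1)
    | succ l =>
      rw [row, List.getD_cons_succ]
      have := j2 l (by omega)
      convert this using 1
      ring

lemma chkL_spec (n : ℕ) : ∀ (L : List ℕ), chkL n L = true → ∀ i < n, L.getD i 0 < L.getD (i+1) 0 := by
  induction n with
  | zero => intro L _ i hi; omega
  | succ n ih =>
    intro L h i hi
    match L, h with
    | [], h => simp [chkL] at h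
    | [_], h => simp [chkL] at h
    | x :: y :: t, h =>
      simp only [chkL, Bool.and_eq_true, decide_eq_true_eq] at h
      cases i with
      | zero => simpa using h.1
      | succ i =>
        have := ih _ h.2 i (by omega)
        simpa using this

lemma base_p {l m k : ℕ} (hl : 8 ≤ l) (hl' : l ≤ 15) (hm : 8 ≤ m) (hm' : m ≤ 15) (hk : 2 ≤ k)
    (hk' : 2 * k ≤ l * m) : p (k-1) l m < p k l m := by
  have h := chk_all
  rw [List.all_eq_true] at h
  have h1 := h (m-8) (by rw [List.mem_range]; omega)
  rw [show 8 + (m - 8) = m by omega, chkM, List.all_eq_true] at h1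
  have h2 := h1 (l-8) (by rw [List.mem_range]; omega)
  rw [show 8 + (l - 8) = l by omega] at h2
  have h3 := chkL_spec _ _ h2 (k-2) (by omega)
  have ht : ∀ (L : List ℕ) i, L.tail.getD i 0 = L.getD (i+1) 0 := by
    intro L i
    cases L <;> simp
  rw [ht, ht, show k - 2 + 1 = k - 1 by omega, show k - 1 + 1 = k by omega] at h3
  have hs := (row_spec m).2 l (by omega)
  have e1 := hs (k-1)
  have e2 := hs k
  rw [← p_eq_G] at e1 e2
  have e1' : ((row m).getD l []).getD (k-1) 0 = p (k-1) l m := by exact_mod_cast e1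
  have e2' : ((row m).getD l []).getD k 0 = p k l m := by exact_mod_cast e2
  omega

/-- multiplicity -/
noncomputable def K (m l k : ℕ) : ℕ := Module.finrank ℝ (Kr m l k)

lemma K_zero (m l : ℕ) : K m l 0 = 1 := by
  rw [K, Kr_zero, finrank_W, card_eq_p, p_zero]

lemma K_add {m l k : ℕ} (h1 : 1 ≤ k) (h2 : 2 * k ≤ l * m) : K m l k + p (k-1) l m = p k l m := by
  have := finrank_Kr (m := m) (l := l) (k := k - 1) (by omega)
  rw [show k - 1 + 1 = k by omega, card_eq_p, card_eq_p] at this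
  exact this

lemma K_symm {m l k : ℕ} (h2 : 2 * k ≤ l * m) : K m l k = K l m k := by
  rcases Nat.eq_zero_or_pos k with rfl | h1
  · rw [K_zero, K_zero]
  · have e1 := K_add h1 h2
    have e2 := K_add (m := l) (l := m) h1 (by rw [mul_comm m l]; exact h2)
    rw [p_symm k, p_symm (k-1)] at e1
    omega

lemma K_mul {m l' k' : ℕ} (h : 1 ≤ K m l' k') (l k : ℕ) : K m l k ≤ K m (l+l') (k+k') := by
  have hne : Kr m l' k' ≠ ⊥ := by
    intro hb
    rw [K, hb] at h
    simp at h
  obtain ⟨F, hF, h0⟩ := Submodule.exists_mem_ne_zero_of_ne_bot hne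
  exact Kr_mul hF h0

def Pos (l m : ℕ) : Prop := ∀ k, (k = 0 ∨ 2 ≤ k) → 2 * k ≤ l * m → 1 ≤ K m l k

lemma Pos_symm {l m : ℕ} (h : Pos l m) : Pos m l := by
  intro k hk hk'
  rw [K_symm hk']
  exact h k hk (by rw [mul_comm l m]; exact hk')

lemma Pos_base {l m : ℕ} (hl : 8 ≤ l) (hl' : l ≤ 15) (hm : 8 ≤ m) (hm' : m ≤ 15) : Pos l m := by
  rintro k (rfl | hk) hk'
  · rw [K_zero]
  · have := base_p hl hl' hm hm' hk hk'
    have := K_add (by omega) hk'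
    omega

lemma Pos_add {l l' m : ℕ} (he : Even (l' * m)) (h : Pos l m) (h' : Pos l' m) (hl : 8 ≤ l * m) (hl' : 4 ≤ l' * m) :
    Pos (l + l') m := by
  intro k hk hk'
  rw [add_mul] at hk'
  obtain ⟨e, he⟩ := he
  have : ∃ k1 k2, k = k1 + k2 ∧ (k1 = 0 ∨ 2 ≤ k1) ∧ (k2 = 0 ∨ 2 ≤ k2) ∧ 2 * k1 ≤ l * m ∧ 2 * k2 ≤ l' * m := by
    generalize l * m = x at *
    generalize l' * m = y at *
    by_cases c1 : k ≤ x / 2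
    · exact ⟨k, 0, by omega, by omega, by omega, by omega, by omega⟩
    · by_cases c2 : k = x / 2 + 1
      · exact ⟨x/2 - 1, 2, by omega, by omega, by omega, by omega, by omega⟩
      · exact ⟨x/2, k - x/2, by omega, by omega, by omega, by omega, by omega⟩
  obtain ⟨k1, k2, rfl, h1, h2, h3, h4⟩ := this
  exact (h k1 h1 h3).trans (K_mul (h' k2 h2 h4) l k1)

lemma Pos_left {m : ℕ} (hm : 8 ≤ m) (h : ∀ l, 8 ≤ l → l ≤ 15 → Pos l m) : ∀ l, 8 ≤ l → Pos l m := by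
  intro l
  induction l using Nat.strong_induction_on with
  | _ l ih =>
    intro hl
    by_cases c : l ≤ 15
    · exact h l hl c
    · have h1 := ih (l-8) (by omega) (by omega)
      have h2 := Pos_add (l := l - 8) (l' := 8) (m := m) ⟨4 * m, by ring⟩ h1 (h 8 le_rfl (by omega))
        (by nlinarith [show 1 ≤ l - 8 by omega]) (by omega)
      rwa [show l - 8 + 8 = l by omega] at h2

lemma Pos_all {l m : ℕ} (hl : 8 ≤ l) (hm : 8 ≤ m) : Pos l m := by
  apply Pos_left hm _ l hl
  intro l' h1 h2
  apply Pos_symm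
  apply Pos_left h1 _ m hm
  intro m' h3 h4
  exact Pos_base h3 h4 h1 h2

/-- middle bound -/
lemma mid_bound (a : ℕ) : (3 * a).choose a ≤
    2 * (2 * a ^ 2 + 1) * (a ^ 2 + 1) ^ 2 * K (2*a) (2*a) (2*a^2) := by
  set I := K (2*a) (2*a) (2*a^2) with hI
  have e0 : a * (2 * a) = 2 * a ^ 2 := by ring
  have hK : ∀ k ≤ a^2, K (2*a) a k ≤ 2 * (2 * a^2 - 2 * k + 1) * I := by
    intro k hk
    have := pos_bound (m := 2*a) (l := a) (k := k) (x := 2*a^2 - 2*k) (even_two_mul a) (by rw [e0]; omega)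
    rw [e0, ← two_mul] at this
    exact this
  have hp : ∀ k ≤ a^2, p k a (2*a) = ∑ j ∈ Finset.range (k+1), K (2*a) a j := by
    intro k
    induction k with
    | zero => intro _; rw [p_zero]; simp [K_zero]
    | succ k ih =>
      intro hk
      rw [Finset.sum_range_succ, ← ih (by omega), ← K_add (m := 2*a) (l := a) (k := k+1) (by omega) (by rw [e0]; omega)]
      simp only [Nat.add_sub_cancel]
      ring
  have hsum : ∀ n, n ≤ a^2 → ∑ j ∈ Finset.range (n+1), (2 * (2 * a^2 - 2 * j + 1) * I) =
      2 * I * ((n+1) * (2 * a^2 - n + 1)) := by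
    intro n
    induction n with
    | zero => intro _; simp; ring
    | succ n ih =>
      intro hn
      rw [Finset.sum_range_succ, ih (by omega)]
      obtain ⟨z, hz⟩ := Nat.exists_eq_add_of_le hn
      rw [hz, show 2 * (n+1+z) - n + 1 = n + 2 * z + 3 by omega,
        show 2 * (n+1+z) - 2 * (n+1) + 1 = 2 * z + 1 by omega,
        show 2 * (n+1+z) - (n+1) + 1 = n + 2 * z + 2 by omega]
      ring
  have hmid : p (a^2) a (2*a) ≤ 2 * I * (a^2+1)^2 := by
    rw [hp _ le_rfl]
    calc _ ≤ _ := Finset.sum_le_sum (fun j hj => hK j (by simpa [Nat.lt_succ_iff] using hj))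
      _ = _ := hsum _ le_rfl
      _ = _ := by rw [show 2 * a^2 - a^2 + 1 = a^2 + 1 by omega]; ring
  have hle1 : ∀ k ≤ a^2, p k a (2*a) ≤ p (a^2) a (2*a) := by
    intro k hk
    rw [hp k hk, hp _ le_rfl]
    apply Finset.sum_le_sum_of_subset
    intro x hx
    simp only [Finset.mem_range] at *
    omega
  have hle2 : ∀ j, p (a^2 + j) a (2*a) ≤ p (a^2) a (2*a) := by
    intro j
    induction j with
    | zero => exact le_rfl
    | succ j ih =>
      have := card_le_of_gt (m := 2*a) (l := a) (k := a^2 + j) (by rw [e0]; omega)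
      rw [card_eq_p, card_eq_p] at this
      exact this.trans ih
  have htot := p_total a (2*a)
  rw [show 2 * a + a = 3 * a by ring, e0] at htot
  rw [← htot]
  calc _ ≤ ∑ k ∈ Finset.range (2*a^2+1), 2 * I * (a^2+1)^2 := by
        apply Finset.sum_le_sum
        intro k _
        refine le_trans ?_ hmid
        by_cases c : k ≤ a^2
        · exact hle1 k c
        · obtain ⟨j, rfl⟩ := Nat.exists_eq_add_of_le (le_of_not_ge c)
          exact hle2 j
    _ = _ := by rw [Finset.sum_const, Finset.card_range, smul_eq_mul]; ring

/-- comparison of a rectangle with a square -/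
lemma K_square {a l m k : ℕ} (hl : 2 * a + 8 ≤ l) (hm : 2 * a + 8 ≤ m) (hk : 2 * k ≤ l * m)
    (hk2 : 2 * a ^ 2 + 2 ≤ k) (ha8 : 8 ≤ 2 * a) : K (2*a) (2*a) (2*a^2) ≤ K m l k := by
  obtain ⟨b, rfl⟩ := Nat.exists_eq_add_of_le (show 2 * a ≤ l by omega)
  obtain ⟨c, rfl⟩ := Nat.exists_eq_add_of_le (show 2 * a ≤ m by omega)
  set t := 2 * a with ht
  have P1 : Pos b t := Pos_all (by omega) ha8
  have P2 : Pos c (t+b) := Pos_all (by omega) (by omega)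
  have hbt : b * t = 2 * (a * b) := by rw [ht]; ring
  have hab : 8 ≤ a * b := by nlinarith [show 8 ≤ b by omega]
  have hcb : 8 ≤ c * (t + b) := by nlinarith [show 8 ≤ c by omega]
  have htot : (t + b) * (t + c) = 4 * a^2 + 2 * (a * b) + c * (t + b) := by rw [ht]; ring
  have : ∃ k1 k2, k = 2 * a^2 + k1 + k2 ∧ (k1 = 0 ∨ 2 ≤ k1) ∧ (k2 = 0 ∨ 2 ≤ k2) ∧ 2 * k1 ≤ b * t ∧
      2 * k2 ≤ c * (t+b) := by
    rw [hbt]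
    rw [htot] at hk
    generalize a * b = x at *
    generalize c * (t + b) = y at *
    generalize a ^ 2 = z at *
    by_cases c1 : k - 2 * z ≤ x
    · exact ⟨k - 2 * z, 0, by omega, by omega, by omega, by omega, by omega⟩
    · by_cases c2 : k - 2 * z = x + 1
      · exact ⟨x - 1, 2, by omega, by omega, by omega, by omega, by omega⟩
      · exact ⟨x, k - 2 * z - x, by omega, by omega, by omega, by omega, by omega⟩
  obtain ⟨k1, k2, rfl, h1, h2, h3, h4⟩ := this
  have e1 := K_mul (P1 k1 h1 h3) t (2*a^2)
  have e2 := K_mul (P2 k2 h2 h4) t (2 * a^2 + k1)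
  have e3 : K t (t+b) (2*a^2 + k1) = K (t+b) t (2*a^2+k1) := K_symm (by
    rw [add_mul, ht] ; rw [ht] at h3; nlinarith)
  have e4 : K (t+c) (t+b) (2*a^2 + k1 + k2) = K (t+b) (t+c) (2*a^2+k1+k2) := K_symm hk
  rw [e4]
  omega

end QB

end

section
namespace QB

lemma choose_step (a : ℕ) : (3*(a+1)).choose (a+1) * ((2*a+1)*(2*a+2)) =
    (3*a).choose a * (3 * (3*a+1)*(3*a+2)) := by
  have h1 := Nat.choose_mul_succ_eq (3*a) a
  have h2 := Nat.choose_mul_succ_eq (3*a+1) a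
  have h3 := Nat.add_one_mul_choose_eq (3*a+2) a
  rw [show 3*a+1-a = 2*a+1 by omega] at h1
  rw [show 3*a+1+1-a = 2*a+2 by omega] at h2
  have h4 : 3 * (3*a+2).choose a = (3*a+3).choose (a+1) := by
    have : (a+1) * (3 * (3*a+2).choose a) = (a+1) * (3*a+3).choose (a+1) := by linarith
    exact Nat.eq_of_mul_eq_mul_left (by omega) this
  rw [show 3 * (a+1) = 3*a+3 by ring, ← h4]
  calc _ = 3 * ((3*a+1+1).choose a * (2*a+2)) * (2*a+1) := by ring
    _ = 3 * ((3*a+1).choose a * (2*a+1)) * (3*a+2) := by rw [← h2]; ring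
    _ = _ := by rw [← h1]; ring

lemma choose_bound (a : ℕ) (ha : 10 ≤ a) : 4^a * a^2 ≤ 6 * (3*a).choose a := by
  induction a, ha using Nat.le_induction with
  | base => decide +kernel
  | succ a ha ih =>
    have h := choose_step a
    have hpoly : 4 * (a+1)^2 * ((2*a+1)*(2*a+2)) ≤ a^2 * (3 * (3*a+1)*(3*a+2)) := by
      obtain ⟨b, rfl⟩ := Nat.exists_eq_add_of_le ha
      ring_nf
      nlinarith [Nat.zero_le b, Nat.zero_le (b^2), Nat.zero_le (b^3), Nat.zero_le (b^4)]
    have hpos : 0 < (2*a+1)*(2*a+2) * a^2 := by positivity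
    refine le_of_mul_le_mul_left ?_ hpos
    calc (2*a+1)*(2*a+2) * a^2 * (4^(a+1) * (a+1)^2)
        = (4^a * a^2) * (4 * (a+1)^2 * ((2*a+1)*(2*a+2))) := by ring
      _ ≤ (6 * (3*a).choose a) * (a^2 * (3 * (3*a+1)*(3*a+2))) := Nat.mul_le_mul ih hpoly
      _ = 6 * a^2 * ((3*a).choose a * (3 * (3*a+1)*(3*a+2))) := by ring
      _ = _ := by rw [← h]; ring

lemma K_lower (a : ℕ) (ha : 10 ≤ a) : 2 * 4^a ≤ 3 * (2*a+1)^4 * K (2*a) (2*a) (2*a^2) := by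
  have h1 := choose_bound a ha
  have h2 := mid_bound a
  set I := K (2*a) (2*a) (2*a^2)
  have h3 : 8 * ((2 * a^2+1) * (a^2+1)^2) ≤ (2*a+1)^4 * a^2 := by
    obtain ⟨b, rfl⟩ := Nat.exists_eq_add_of_le ha
    ring_nf
    nlinarith [Nat.zero_le b, Nat.zero_le (b^2), Nat.zero_le (b^3), Nat.zero_le (b^4), Nat.zero_le (b^5)]
  have hpos : 0 < 4 * a^2 := by positivity
  refine le_of_mul_le_mul_left ?_ hpos
  calc 4 * a^2 * (2 * 4^a) = 8 * (4^a * a^2) := by ring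
    _ ≤ 8 * (6 * (2 * (2 * a ^ 2 + 1) * (a ^ 2 + 1) ^ 2 * I)) := by omega
    _ = 12 * I * (8 * ((2 * a^2+1) * (a^2+1)^2)) := by ring
    _ ≤ 12 * I * ((2*a+1)^4 * a^2) := Nat.mul_le_mul_left _ h3
    _ = _ := by ring

lemma const_le : 3 * Real.sqrt 3 / (2 * Real.sqrt 2 * Real.pi ^ ((3 : ℝ) / 2)) ≤ 1 / 3 := by
  have hpi : (0:ℝ) < Real.pi := Real.pi_pos
  have hx : (0:ℝ) < Real.pi ^ ((3 : ℝ) / 2) := Real.rpow_pos_of_pos hpi _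
  have hx2 : (Real.pi ^ ((3 : ℝ) / 2)) ^ 2 = Real.pi ^ 3 := by
    rw [← Real.rpow_natCast, ← Real.rpow_mul hpi.le, ← Real.rpow_natCast]
    norm_num
  have h3 : (243 : ℝ) ≤ 8 * Real.pi ^ 3 := by
    have : (3.14 : ℝ) ^ 3 ≤ Real.pi ^ 3 := pow_le_pow_left₀ (by norm_num) Real.pi_gt_d2.le 3
    norm_num at this
    linarith
  rw [div_le_div_iff₀ (by positivity) (by norm_num)]
  have hs : (3 * Real.sqrt 3 * 3) ^ 2 ≤ (1 * (2 * Real.sqrt 2 * Real.pi ^ ((3 : ℝ) / 2))) ^ 2 := by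
    have e1 : Real.sqrt 3 ^ 2 = 3 := Real.sq_sqrt (by norm_num)
    have e2 : Real.sqrt 2 ^ 2 = 2 := Real.sq_sqrt (by norm_num)
    calc _ = 81 * Real.sqrt 3 ^ 2 := by ring
      _ ≤ 4 * Real.sqrt 2 ^ 2 * (Real.pi ^ ((3 : ℝ) / 2)) ^ 2 := by rw [e1, e2, hx2]; linarith
      _ = _ := by ring
  exact (pow_le_pow_iff_left₀ (by positivity) (by positivity) two_ne_zero).mp hs

lemma small_aux {s : ℝ} (h1 : 1 ≤ s) (h2 : s < 21) : ((2:ℝ) ^ s) ^ 2 ≤ 9 * s ^ 9 := by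
  have key : ∀ (x y : ℝ), 0 ≤ x → x ≤ s → s ≤ y → ((2:ℝ)^y)^2 ≤ 9 * x^9 → ((2:ℝ) ^ s) ^ 2 ≤ 9 * s ^ 9 := by
    intro x y hx hxs hsy h
    calc ((2:ℝ) ^ s) ^ 2 ≤ ((2:ℝ)^y)^2 := by
          gcongr
          norm_num
      _ ≤ 9 * x^9 := h
      _ ≤ _ := by gcongr
  by_cases c : s ≤ 3/2
  · refine key 1 (3/2) (by norm_num) h1 c ?_
    rw [← Real.rpow_natCast, ← Real.rpow_mul (by norm_num)]
    norm_num
  by_cases c2 : s ≤ 2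
  · refine key (3/2) 2 (by norm_num) (by linarith) c2 (by norm_num)
  · have hf1 := Nat.floor_le (show 0 ≤ s by linarith)
    have hf2 := (Nat.lt_floor_add_one s).le
    have hf3 : 2 ≤ ⌊s⌋₊ := Nat.le_floor (by push_cast; linarith)
    have hf4 : ⌊s⌋₊ < 21 := (Nat.floor_lt (by linarith)).mpr (by exact_mod_cast h2)
    refine key _ _ (Nat.cast_nonneg _) hf1 hf2 ?_
    rw [show ((⌊s⌋₊ : ℝ) + 1) = ((⌊s⌋₊ + 1 : ℕ) : ℝ) by push_cast; ring, Real.rpow_natCast]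
    generalize ⌊s⌋₊ = j at *
    clear hf1 hf2
    interval_cases j <;> norm_num

lemma final (l m k n : ℕ) (hl : 8 ≤ l) (hlm : l ≤ m) (hk2 : 2 ≤ k) (hk : 2 * k ≤ l * m)
    (hn : n + 8 ≤ l) (hn1 : 1 ≤ n) :
    (p k l m : ℝ) - p (k - 1) l m ≥
      (3 * Real.sqrt 3 / (2 * Real.sqrt 2 * Real.pi ^ ((3 : ℝ) / 2))) *
        2 ^ Real.sqrt (2 * min (k : ℝ) ((n : ℝ) ^ 2 / 2)) /
          (2 * min (k : ℝ) ((n : ℝ) ^ 2 / 2)) ^ ((9 : ℝ) / 4) := by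
  have hK := K_add (m := m) (l := l) (k := k) (by omega) hk
  have hKr : (p k l m : ℝ) - p (k - 1) l m = K m l k := by
    rw [← hK]; push_cast; ring
  rw [hKr]
  set z : ℝ := 2 * min (k : ℝ) ((n : ℝ) ^ 2 / 2) with hz
  set s := Real.sqrt z with hs
  have hk2' : (2:ℝ) ≤ k := by exact_mod_cast hk2
  have hn1' : (1:ℝ) ≤ n := by exact_mod_cast hn1
  have hz1 : 1 ≤ z := by
    have : (1:ℝ)/2 ≤ min (k : ℝ) ((n : ℝ) ^ 2 / 2) := le_min (by linarith) (by nlinarith)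
    linarith
  have hzk : z ≤ 2 * k := by have := min_le_left (k : ℝ) ((n : ℝ) ^ 2 / 2); linarith
  have hzn : z ≤ n ^ 2 := by have := min_le_right (k : ℝ) ((n : ℝ) ^ 2 / 2); linarith
  have hs2 : s ^ 2 = z := Real.sq_sqrt (by linarith)
  have hs1 : 1 ≤ s := Real.one_le_sqrt.mpr hz1
  have hsn : s ≤ n := Real.sqrt_le_iff.mpr ⟨by linarith, hzn⟩
  set Y := z ^ ((9 : ℝ) / 4) with hY
  have hYpos : 0 < Y := Real.rpow_pos_of_pos (by linarith) _
  have hY2 : Y ^ 2 = s ^ 9 := by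
    rw [hY, ← hs2, ← Real.rpow_natCast, ← Real.rpow_mul (by positivity), ← Real.rpow_natCast s 2,
      ← Real.rpow_mul (by linarith), ← Real.rpow_natCast s 9]
    norm_num
  have h2s : (0:ℝ) < 2 ^ s := Real.rpow_pos_of_pos (by norm_num) _
  rw [ge_iff_le, div_le_iff₀ hYpos]
  refine le_trans (mul_le_mul_of_nonneg_right const_le h2s.le) ?_
  by_cases c : s < 21
  · have h1 := small_aux hs1 c
    rw [← hY2] at h1
    have h2 : (2:ℝ) ^ s ≤ 3 * Y := by
      apply (pow_le_pow_iff_left₀ h2s.le (by positivity) two_ne_zero).mp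
      calc _ ≤ _ := h1
        _ = _ := by ring
    have h3 : 1 ≤ K m l k := Pos_all hl (hl.trans hlm) k (Or.inr hk2) hk
    have h3' : (1:ℝ) ≤ K m l k := by exact_mod_cast h3
    have h5 : 1 * Y ≤ K m l k * Y := mul_le_mul_of_nonneg_right h3' hYpos.le
    linarith
  · push Not at c
    set a := ⌊(s-1)/2⌋₊ with ha
    have ha1 : (a:ℝ) ≤ (s-1)/2 := Nat.floor_le (by linarith)
    have ha2 : (s-1)/2 < a + 1 := Nat.lt_floor_add_one _
    have ha10 : 10 ≤ a := Nat.le_floor (by push_cast; linarith)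
    have hal : 2 * a + 8 ≤ l := by
      have : (2 * a : ℝ) ≤ n := by linarith
      have : 2 * a ≤ n := by exact_mod_cast this
      omega
    have hak : 2 * a ^ 2 + 2 ≤ k := by
      have : (2 * a ^ 2 + 2 : ℝ) ≤ k := by
        have hq : (2 * (a:ℝ))^2 ≤ (s-1)^2 := pow_le_pow_left₀ (by positivity) (by linarith) 2
        have e1 : (2 * (a:ℝ))^2 = 4 * (a:ℝ)^2 := by ring
        have e2 : (s-1)^2 = z - 2 * s + 1 := by rw [← hs2]; ring
        rw [e1, e2] at hq
        linarith
      exact_mod_cast this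
    have hsq := K_square (a := a) (l := l) (m := m) (k := k) hal (by omega) hk hak (by omega)
    have hlow := K_lower a ha10
    have h4 : 2 * 4^a ≤ 3 * (2*a+1)^4 * K m l k := hlow.trans (Nat.mul_le_mul_left _ hsq)
    have h4' : (2 * 4^a : ℝ) ≤ 3 * (2*a+1)^4 * K m l k := by exact_mod_cast h4
    have hYl : 4 * (2*a+1 : ℝ)^4 ≤ Y := by
      apply (pow_le_pow_iff_left₀ (by positivity) hYpos.le two_ne_zero).mp
      rw [hY2]
      calc (4 * (2*a+1 : ℝ)^4)^2 = 16 * (2 * a + 1 : ℝ)^8 := by ring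
        _ ≤ s * s^8 := by
          gcongr
          · linarith
          · linarith
        _ = s^9 := by ring
    have h2l : (2:ℝ)^s ≤ 8 * 4^a := by
      calc (2:ℝ)^s ≤ (2:ℝ)^((2*a+3 : ℕ) : ℝ) := by
            apply Real.rpow_le_rpow_of_exponent_le (by norm_num)
            push_cast; linarith
        _ = _ := by rw [Real.rpow_natCast, pow_add, pow_mul]; norm_num; ring
    have hK0 : (0:ℝ) ≤ K m l k := Nat.cast_nonneg _
    calc (1/3 : ℝ) * 2^s ≤ 1/3 * (8 * 4^a) := by gcongr
      _ ≤ K m l k * (4 * (2*a+1 : ℝ)^4) := by linarith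
      _ ≤ _ := by gcongr

end QB

end

theorem stmt_13 (l m k : ℕ) (hl : 8 ≤ l) (hlm : l ≤ m) (hk2 : 2 ≤ k) (hk : 2 * k ≤ l * m)
    (n : ℕ) (hn : n = if Even (l * m) then 2 * ((l - 8) / 2) else 2 * ((l - 8) / 2) - 1)
    (hn1 : 1 ≤ n) :
    (p k l m : ℝ) - p (k - 1) l m ≥
      (3 * Real.sqrt 3 / (2 * Real.sqrt 2 * Real.pi ^ ((3 : ℝ) / 2))) *
        2 ^ Real.sqrt (2 * min (k : ℝ) ((n : ℝ) ^ 2 / 2)) /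
          (2 * min (k : ℝ) ((n : ℝ) ^ 2 / 2)) ^ ((9 : ℝ) / 4) := by
  apply QB.final l m k n hl hlm hk2 hk _ hn1
  split_ifs at hn <;> omega
end

section
/- For every integer r ≥ 4, setting k = 2r(r+1), we have b_k(2r+1) − b_{k−1}(2r+1) ≥ 4^r / (3 · (2r)^{9/2}). -/
/-- `b k n`: the coefficient of `q^k` in `∏_{i=1}^{n} (1 + q^(2i-1))`, i.e. the number of
partitions of `k` into distinct odd parts each at most `2n-1`. -/
noncomputable def b (k n : ℕ) : ℕ :=
  (∏ i ∈ Finset.range n, (1 + (Polynomial.X : Polynomial ℕ) ^ (2 * i + 1))).coeff k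

theorem digit_aux (B : ℕ) (k : ℕ) : ∀ p : Polynomial ℕ, (∀ j, p.coeff j < B) →
    p.eval B / B ^ k % B = p.coeff k := by
  induction k with
  | zero =>
    intro p hp
    have h := Polynomial.divX_mul_X_add p
    have h2 : p.eval B = p.divX.eval B * B + p.coeff 0 := by
      conv_lhs => rw [← h]
      simp
    rw [h2, pow_zero, Nat.div_one, mul_comm, Nat.mul_add_mod, Nat.mod_eq_of_lt (hp 0)]
  | succ k ih =>
    intro p hp
    have h := Polynomial.divX_mul_X_add p
    have h2 : p.eval B = p.divX.eval B * B + p.coeff 0 := by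
      conv_lhs => rw [← h]
      simp
    have hB : 0 < B := lt_of_le_of_lt (Nat.zero_le _) (hp 0)
    have h3 : p.eval B / B = p.divX.eval B := by
      rw [h2, mul_comm, Nat.mul_add_div hB, Nat.div_eq_of_lt (hp 0), add_zero]
    rw [pow_succ', ← Nat.div_div_eq_div_mul, h3, ih _ (fun j => by simpa using hp (j+1))]
    simp

def prodB (w : ℕ) : ℕ → ℕ
  | 0 => 1
  | n+1 => prodB w n * (1 + 2 ^ (w * (2 * n + 1)))

theorem prodB_eq (w n : ℕ) : prodB w n =
    (∏ i ∈ Finset.range n, (1 + (Polynomial.X : Polynomial ℕ) ^ (2 * i + 1))).eval (2 ^ w) := by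
  induction n with
  | zero => simp [prodB]
  | succ n ih => 
    rw [Finset.prod_range_succ, Polynomial.eval_mul, ← ih, prodB]
    simp [pow_mul]

theorem coeff_lt (n j : ℕ) : b j n < 2 ^ (n + 1) := by
  have h : ∀ j, b j n ≤ 2 ^ n := by
    induction n with
    | zero => intro j; simp [b, Polynomial.coeff_one]; split_ifs <;> simp
    | succ n ih =>
      intro j
      have h1 := ih j
      have h2 := ih (j - (2 * n + 1))
      unfold b at *
      rw [Finset.prod_range_succ, mul_add, mul_one, Polynomial.coeff_add, Polynomial.coeff_mul_X_pow', pow_succ]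
      split_ifs <;> omega
  have := h j
  have h3 : 2 ^ n < 2 ^ (n+1) := Nat.pow_lt_pow_right (by norm_num) (by omega)
  omega

theorem b_digit (w k n : ℕ) (hw : n + 1 ≤ w) : b k n = (prodB w n >>> (w * k)) % 2 ^ w := by
  rw [Nat.shiftRight_eq_div_pow, prodB_eq, pow_mul, digit_aux _ k _
    (fun j => lt_of_lt_of_le (coeff_lt n j) (Nat.pow_le_pow_right (by norm_num) hw))]
  rfl

def chk (r N : ℕ) : Bool :=
  Nat.ble (4 ^ r + 3 * (2 * r) ^ 4 * Nat.sqrt (2 * r) * ((N >>> (200 * (2*r*(r+1)-1))) % 2 ^ 200))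
    (3 * (2 * r) ^ 4 * Nat.sqrt (2 * r) * ((N >>> (200 * (2*r*(r+1)))) % 2 ^ 200))

def chkLoop : ℕ → ℕ → ℕ → Bool
  | 0, _, _ => true
  | f+1, r, N => chk r N && chkLoop f (r+1)
      (N * (1 + 2 ^ (200 * (2 * (2 * r + 1) + 1))) * (1 + 2 ^ (200 * (2 * (2 * r + 2) + 1))))

theorem chkLoop_spec (f : ℕ) : ∀ r, chkLoop f r (prodB 200 (2 * r + 1)) = true →
    ∀ s, r ≤ s → s < r + f → chk s (prodB 200 (2 * s + 1)) = true := by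
  induction f with
  | zero => intro r _ s h1 h2; omega
  | succ f ih =>
    intro r h s h1 h2
    rw [chkLoop, Bool.and_eq_true] at h
    rcases eq_or_lt_of_le h1 with h3 | h3
    · rw [← h3]; exact h.1
    · exact ih (r+1) h.2 s h3 (by omega)

theorem chk_loop_true : chkLoop 96 4 (prodB 200 (2 * 4 + 1)) = true := by
  decide +kernel

theorem chk_all (r : ℕ) (h1 : r < 100) (h2 : 4 ≤ r) : chk r (prodB 200 (2 * r + 1)) = true :=
  chkLoop_spec 96 4 chk_loop_true r h2 (by omega)

section
open Real

theorem b_succ (k n : ℕ) : b k (n+1) = b k n + if 2 * n + 1 ≤ k then b (k - (2 * n + 1)) n else 0 := by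
  unfold b
  rw [Finset.prod_range_succ, mul_add, mul_one, Polynomial.coeff_add, Polynomial.coeff_mul_X_pow']

theorem four_aux (n : ℕ) : ∀ m : ℤ,
    ∫ θ in (-(π/2))..(π/2), (∏ i ∈ Finset.range n, (2 * cos ((2 * i + 1) * θ))) * cos (((n:ℝ)^2 - 2 * m) * θ)
      = π * (if 0 ≤ m then (b m.toNat n : ℝ) else 0) := by
  induction n with
  | zero =>
    intro m
    by_cases hm : m = 0
    · subst hm; simp [b]
    · have h0 : (m:ℝ) ≠ 0 := by exact_mod_cast hm
      have h1 : (if 0 ≤ m then (b m.toNat 0 : ℝ) else 0) = 0 := by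
        split_ifs with h
        · have : m.toNat ≠ 0 := by omega
          simp [b, Polynomial.coeff_one, this]
        · rfl
      rw [h1]
      have : ∀ θ : ℝ, (∏ i ∈ Finset.range 0, (2 * cos ((2 * (i:ℕ) + 1) * θ))) * cos ((((0:ℕ):ℝ)^2 - 2 * m) * θ) = cos ((-2 * m) * θ) := by
        intro θ; simp
      simp_rw [this]
      rw [intervalIntegral.integral_comp_mul_left (fun x => cos x) (by simpa using h0), integral_cos]
      have e1 : -2 * (m:ℝ) * (π/2) = -(m * π) := by ring
      have e2 : -2 * (m:ℝ) * (-(π/2)) = (m * π) := by ring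
      rw [e1, e2, sin_neg, sin_int_mul_pi]; simp
  | succ n ih =>
    intro m
    have key : ∀ θ : ℝ, (∏ i ∈ Finset.range (n+1), (2 * cos ((2 * i + 1) * θ))) * cos ((((n+1:ℕ):ℝ)^2 - 2 * m) * θ)
      = (∏ i ∈ Finset.range n, (2 * cos ((2 * i + 1) * θ))) * cos (((n:ℝ)^2 - 2 * m) * θ)
       + (∏ i ∈ Finset.range n, (2 * cos ((2 * i + 1) * θ))) * cos (((n:ℝ)^2 - 2 * (m - (2 * n + 1) : ℤ)) * θ) := by
      intro θ
      rw [Finset.prod_range_succ]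
      have e1 : (((n:ℝ)^2 - 2 * m) * θ) = (((n+1:ℕ):ℝ)^2 - 2 * m) * θ - (2 * n + 1) * θ := by push_cast; ring
      have e2 : (((n:ℝ)^2 - 2 * (m - (2 * n + 1) : ℤ)) * θ) = (((n+1:ℕ):ℝ)^2 - 2 * m) * θ + (2 * n + 1) * θ := by push_cast; ring
      rw [e1, e2, cos_add, cos_sub]; ring
    simp_rw [key]
    rw [intervalIntegral.integral_add, ih, ih, ← mul_add]
    · congr 1
      rw [b_succ]
      by_cases h : 0 ≤ m
      · by_cases h2 : 2 * (n:ℤ) + 1 ≤ m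
        · have a1 : 0 ≤ m - (2 * (n:ℤ) + 1) := by omega
          have a2 : 2 * n + 1 ≤ m.toNat := by omega
          have a3 : (m - (2 * (n:ℤ) + 1)).toNat = m.toNat - (2 * n + 1) := by omega
          rw [if_pos h, if_pos a1, if_pos h, if_pos a2, a3]; push_cast; ring
        · have a1 : ¬ 0 ≤ m - (2 * (n:ℤ) + 1) := by omega
          have a2 : ¬ 2 * n + 1 ≤ m.toNat := by omega
          rw [if_pos h, if_neg a1, if_pos h, if_neg a2]; push_cast; ring
      · have a1 : ¬ 0 ≤ m - (2 * (n:ℤ) + 1) := by omega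
        rw [if_neg h, if_neg a1, if_neg h]; ring
    all_goals exact Continuous.intervalIntegrable (by fun_prop) _ _

noncomputable def CC (n : ℕ) (θ : ℝ) : ℝ := ∏ i ∈ Finset.range n, cos ((2 * i + 1) * θ)

theorem CC_cont (n : ℕ) : Continuous (CC n) := by unfold CC; fun_prop

theorem diff_eq (r : ℕ) (hr : 1 ≤ r) :
    (b (2 * r * (r + 1)) (2 * r + 1) : ℝ) - b (2 * r * (r + 1) - 1) (2 * r + 1) =
    2 ^ (2 * r + 1) / π * ∫ θ in (-(π/2))..(π/2), CC (2*r+1) θ * (4 * sin θ ^ 2 * cos θ) := by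
  have hk : 1 ≤ 2 * r * (r+1) := by nlinarith
  have h1 := four_aux (2*r+1) ((2 * r * (r + 1) : ℕ) : ℤ)
  have h2 := four_aux (2*r+1) ((2 * r * (r + 1) - 1 : ℕ) : ℤ)
  rw [if_pos (by positivity), Int.toNat_natCast] at h1 h2
  have h3 : π * ((b (2 * r * (r + 1)) (2 * r + 1) : ℝ) - b (2 * r * (r + 1) - 1) (2 * r + 1)) =
     2 ^ (2 * r + 1) * ∫ θ in (-(π/2))..(π/2), CC (2*r+1) θ * (4 * sin θ ^ 2 * cos θ) := by
    rw [mul_sub, ← h1, ← h2, ← intervalIntegral.integral_sub, ← intervalIntegral.integral_const_mul]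
    · congr 1
      ext θ
      rw [Finset.prod_mul_distrib, Finset.prod_const, Finset.card_range, ← CC]
      have e1 : (((2*r+1:ℕ):ℝ)^2 - 2 * (((2 * r * (r + 1) : ℕ) : ℤ):ℝ)) * θ = θ := by push_cast; ring
      have e2 : (((2*r+1:ℕ):ℝ)^2 - 2 * (((2 * r * (r + 1) - 1 : ℕ) : ℤ):ℝ)) * θ = 3 * θ := by
        push_cast [Nat.cast_sub hk]; ring
      rw [e1, e2, cos_three_mul, sin_sq]; ring
    all_goals exact Continuous.intervalIntegrable (by fun_prop) _ _
  rw [div_mul_eq_mul_div, eq_div_iff pi_ne_zero, ← h3]; ring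

theorem sum_id (n : ℕ) (θ : ℝ) : 2 * sin (2 * θ) * ∑ i ∈ Finset.range n, cos (2 * ((2 * i + 1) * θ)) = sin (4 * n * θ) := by
  induction n with
  | zero => simp
  | succ n ih =>
    rw [Finset.sum_range_succ, mul_add, ih]
    have e1 : 4 * (n:ℝ) * θ = 2 * ((2 * n + 1) * θ) - 2 * θ := by ring
    have e2 : 4 * ((n+1:ℕ):ℝ) * θ = 2 * ((2 * n + 1) * θ) + 2 * θ := by push_cast; ring
    rw [e1, e2, sin_add, sin_sub]; ring

theorem S_le (n : ℕ) (hn : 1 ≤ n) (θ : ℝ) (h1 : π / (4 * n) ≤ θ) (h2 : θ ≤ π/2) :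
    ∑ i ∈ Finset.range n, cos (2 * ((2 * i + 1) * θ)) ≤ n / 2 := by
  have hn' : (1:ℝ) ≤ n := by exact_mod_cast hn
  have hpi := pi_pos
  have hpos : 0 < θ := lt_of_lt_of_le (by positivity) h1
  have hid := sum_id n θ
  set S := ∑ i ∈ Finset.range n, cos (2 * ((2 * (i:ℝ) + 1) * θ)) with hS
  rcases eq_or_lt_of_le h2 with h | h
  · have : S ≤ 0 := by
      rw [hS]
      apply Finset.sum_nonpos
      intro i _
      have : 2 * ((2 * (i:ℝ) + 1) * θ) = π + i * (2 * π) := by rw [h]; ring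
      rw [this, cos_add_nat_mul_two_pi]; simp
    linarith
  · have hs : 0 < sin (2 * θ) := sin_pos_of_pos_of_lt_pi (by linarith) (by linarith)
    by_cases hc : θ ≤ π/2 - π/(4*n)
    · have hb : 1 / (n:ℝ) ≤ sin (2 * θ) := by
        have e : 2 / π * (2 * (π / (4 * n))) = 1 / (n:ℝ) := by field_simp; norm_num
        rcases le_total (2 * θ) (π/2) with h3 | h3
        · refine le_trans ?_ (mul_le_sin (by linarith) h3)
          rw [← e]; gcongr
        · rw [← sin_pi_sub]
          refine le_trans ?_ (mul_le_sin (by linarith) (by linarith))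
          rw [← e]; gcongr; linarith
      have h4 : 1 ≤ n * sin (2*θ) := by
        rw [div_le_iff₀ (by linarith)] at hb; linarith
      have h5 := sin_le_one (4 * n * θ)
      by_contra hcon
      push Not at hcon
      nlinarith
    · push Not at hc
      have h6 : sin (4 * n * θ) ≤ 0 := by
        have e : sin (4 * n * θ) = - sin (n * (2 * π) - 4 * n * θ) := by
          rw [sin_nat_mul_two_pi_sub]; simp
        rw [e, neg_nonpos]
        have e3 : (n:ℝ) * (2 * π) - 4 * n * θ = 4 * n * (π/2 - θ) := by ring
        rw [e3]
        apply sin_nonneg_of_nonneg_of_le_pi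
        · have : 0 ≤ π/2 - θ := by linarith
          positivity
        · have : π/2 - θ ≤ π/(4*n) := by linarith
          rw [le_div_iff₀ (by linarith)] at this; linarith
      have : S ≤ 0 := by
        by_contra hcon
        push Not at hcon
        nlinarith
      linarith

theorem CC_abs (n : ℕ) (θ : ℝ) : CC n |θ| = CC n θ := by
  unfold CC
  rcases abs_choice θ with h | h <;> rw [h]
  simp

theorem CC_tail (n : ℕ) (hn : 1 ≤ n) (θ : ℝ) (h1 : π / (4 * n) ≤ θ) (h2 : θ ≤ π/2) :
    CC n θ ^ 2 ≤ (3/4) ^ n := by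
  have hs := S_le n hn θ h1 h2
  have hx : ∀ x : ℝ, x ≤ 3/4 * exp (x / (3/4) - 1) := by
    intro x
    have := add_one_le_exp (x / (3/4) - 1)
    linarith
  unfold CC
  rw [← Finset.prod_pow]
  calc ∏ i ∈ Finset.range n, cos ((2 * i + 1) * θ) ^ 2 
      ≤ ∏ i ∈ Finset.range n, (3/4 * exp (cos ((2 * i + 1) * θ) ^ 2 / (3/4) - 1)) := 
        Finset.prod_le_prod (fun i _ => sq_nonneg _) (fun i _ => hx _)
    _ = (3/4)^n * exp (∑ i ∈ Finset.range n, (cos ((2 * i + 1) * θ) ^ 2 / (3/4) - 1)) := by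
        rw [Finset.prod_mul_distrib, exp_sum, Finset.prod_const, Finset.card_range]
    _ ≤ (3/4)^n * 1 := by
        gcongr
        rw [exp_le_one_iff]
        have : ∑ i ∈ Finset.range n, (cos ((2 * (i:ℝ) + 1) * θ) ^ 2 / (3/4) - 1) = 
          2/3 * ∑ i ∈ Finset.range n, cos (2 * ((2 * (i:ℝ) + 1) * θ)) - n/3 := by
          rw [Finset.mul_sum]
          have : (n:ℝ)/3 = ∑ i ∈ Finset.range n, (1/3:ℝ) := by simp; ring
          rw [this, ← Finset.sum_sub_distrib]
          apply Finset.sum_congr rfl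
          intro i _
          rw [cos_two_mul]; ring
        rw [this]; linarith
    _ = _ := mul_one _

theorem CC_nonneg (n : ℕ) (hn : 1 ≤ n) (θ : ℝ) (h0 : 0 ≤ θ) (h1 : θ ≤ π / (4 * n)) : 0 ≤ CC n θ := by
  unfold CC
  apply Finset.prod_nonneg
  intro i hi
  have hi' : (i:ℝ) + 1 ≤ n := by exact_mod_cast Finset.mem_range.mp hi
  have hn' : (1:ℝ) ≤ n := by exact_mod_cast hn
  rw [le_div_iff₀ (by linarith)] at h1
  have := pi_pos
  apply cos_nonneg_of_neg_pi_div_two_le_of_le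
  · have : 0 ≤ (2 * (i:ℝ) + 1) * θ := by positivity
    linarith
  · nlinarith

theorem CC_lower (n : ℕ) (θ : ℝ) (h0 : 0 ≤ θ) (h1 : 2 * n * θ ≤ π/2) :
    0 ≤ CC n θ ∧ CC n θ ≤ 1 ∧ 1 - n * (4 * n^2 - 1) / 6 * θ^2 ≤ CC n θ := by
  induction n with
  | zero => simp [CC]
  | succ n ih =>
    push_cast at h1
    obtain ⟨a, c, d⟩ := ih (by nlinarith)
    have e : CC (n+1) θ = CC n θ * cos ((2 * n + 1) * θ) := by
      unfold CC; rw [Finset.prod_range_succ]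
    have hc0 : 0 ≤ cos ((2 * n + 1) * θ) := by
      apply cos_nonneg_of_neg_pi_div_two_le_of_le
      · have : 0 ≤ (2 * (n:ℝ) + 1) * θ := by positivity
        linarith [pi_pos]
      · nlinarith
    have hc1 := cos_le_one ((2 * n + 1) * θ)
    have hc2 := one_sub_sq_div_two_le_cos (x := (2 * n + 1) * θ)
    rw [e]
    refine ⟨mul_nonneg a hc0, mul_le_one₀ c hc0 hc1, ?_⟩
    have h3 : CC n θ * (1 - ((2 * n + 1) * θ)^2/2) ≤ CC n θ * cos ((2 * n + 1) * θ) := by gcongr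
    have h4 : 0 ≤ (1 - CC n θ) * (((2 * n + 1) * θ)^2/2) := mul_nonneg (by linarith) (by positivity)
    push_cast
    nlinarith

theorem sin_lower (x : ℝ) (h0 : 0 ≤ x) (h1 : x ≤ 1/10) : 9/10 * x^2 ≤ sin x ^ 2 * cos x := by
  have hc := one_sub_sq_div_two_le_cos (x := x)
  have hs : 0.99 * x ≤ sin x := by
    rcases eq_or_lt_of_le h0 with h | h
    · simp [← h]
    · have := sin_gt_sub_cube h
      nlinarith [mul_nonneg h0 (mul_nonneg (sub_nonneg.2 h1) (by linarith : 0 ≤ 1/10 + x))]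
  have hc' : 0.99 ≤ cos x := by nlinarith
  have h2 : (0.99*x)^2 ≤ sin x ^2 := by gcongr
  have : (0.99*x)^2 * 0.99 ≤ sin x ^2 * cos x := by gcongr
  nlinarith [sq_nonneg x]

theorem pow_bound (n : ℕ) (hn : 201 ≤ n) : (n:ℝ)^9 * 6400 * (3/4)^n ≤ 1 := by
  induction n, hn using Nat.le_induction with
  | base => norm_num
  | succ n hn ih =>
    have hn' : (201:ℝ) ≤ n := by exact_mod_cast hn
    have h : ((n+1:ℕ):ℝ)^9 * (3/4) ≤ (n:ℝ)^9 := by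
      have h1 : ((n+1:ℕ):ℝ) ≤ 202/201 * n := by push_cast; linarith
      calc ((n+1:ℕ):ℝ)^9 * (3/4) ≤ (202/201 * n)^9 * (3/4) := by gcongr
        _ = ((202/201)^9 * (3/4)) * (n:ℝ)^9 := by ring
        _ ≤ 1 * (n:ℝ)^9 := by gcongr; norm_num
        _ = _ := one_mul _
    calc ((n+1:ℕ):ℝ)^9 * 6400 * (3/4)^(n+1) = (((n+1:ℕ):ℝ)^9 * (3/4)) * 6400 * (3/4)^n := by ring
      _ ≤ (n:ℝ)^9 * 6400 * (3/4)^n := by gcongr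
      _ ≤ 1 := ih

theorem int_lower (n : ℕ) (hn : 201 ≤ n) (d : ℝ) (hd : 0 < d) (hdn : d^2 * n^3 = 1) :
    1.44 * d^3 - 4 * π * (d^3 / 80) ≤ ∫ θ in (-(π/2))..(π/2), CC n θ * (4 * sin θ ^ 2 * cos θ) := by
  have hn' : (201:ℝ) ≤ n := by exact_mod_cast hn
  have hnd : n * d ≤ 1/10 := by
    by_contra h
    push Not at h
    have h1 : (1/10)^2 < (n*d)^2 := by gcongr
    have : (n*d)^2 * n = 1 := by rw [← hdn]; ring
    nlinarith
  have hd1 : d ≤ 1/10 := by nlinarith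
  have hpi := pi_gt_three
  have hpi4 := pi_le_four
  set G : ℝ → ℝ := fun θ => CC n θ * (4 * sin θ ^ 2 * cos θ) with hG
  have hGc : Continuous G := by
    have := CC_cont n
    fun_prop
  have hGabs : ∀ θ, G |θ| = G θ := by
    intro θ
    simp only [hG, CC_abs, cos_abs]
    rcases abs_choice θ with h | h <;> rw [h]
    simp
  have hi : ∀ x y, IntervalIntegrable G MeasureTheory.volume x y := fun x y => hGc.intervalIntegrable _ _
  have heps : ∀ θ, |θ| ≤ π/2 → -(4 * (d^3/80)) ≤ G θ := by
    intro θ hθ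
    rw [← hGabs]
    have h0 := abs_nonneg θ
    generalize |θ| = t at *
    have hc : 0 ≤ cos t := cos_nonneg_of_neg_pi_div_two_le_of_le (by linarith) hθ
    have hw0 : 0 ≤ 4 * sin t ^ 2 * cos t := by positivity
    have hw1 : 4 * sin t ^ 2 * cos t ≤ 4 := by
      have h1 := sin_sq_le_one t
      have h2 := cos_le_one t
      have := mul_le_one₀ h1 hc h2
      linarith
    rcases le_total t (π/(4*n)) with h | h
    · have := mul_nonneg (CC_nonneg n (by omega) t h0 h) hw0
      have h5 : 0 ≤ d^3 := by positivity
      simp only [hG]; linarith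
    · have h3 := CC_tail n (by omega) t h hθ
      have h4 : ((3:ℝ)/4)^n ≤ (d^3/80)^2 := by
        have h5 := pow_bound n hn
        have h6 : (d^3/80)^2 * (n^9*6400) = 1 := by
          calc (d^3/80)^2 * (n^9*6400) = (d^2*n^3)^3 := by ring
            _ = 1 := by rw [hdn]; norm_num
        have h7 : 0 < (n:ℝ)^9 * 6400 := by positivity
        by_contra hcon
        push Not at hcon
        nlinarith
      have h8 : |CC n t| ≤ d^3/80 := abs_le_of_sq_le_sq (h3.trans h4) (by positivity)
      have h9 := (abs_le.mp h8).1
      simp only [hG]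
      have h5 : 0 ≤ d^3 := by positivity
      nlinarith
  have hmid : ∀ θ, |θ| ≤ d → 3.6 * (θ^2 - 2/3 * n^3 * θ^4) ≤ G θ := by
    intro θ hθ
    have e2 : θ^2 = |θ|^2 := (sq_abs θ).symm
    have e4 : θ^4 = |θ|^4 := by rw [show (4:ℕ) = 2*2 from rfl, pow_mul, pow_mul, sq_abs]
    rw [← hGabs, e2, e4]
    have h0 := abs_nonneg θ
    generalize |θ| = t at *
    obtain ⟨a, c, l⟩ := CC_lower n t h0 (by nlinarith)
    have hs := sin_lower t h0 (by linarith)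
    have l2 : 1 - 2/3 * n^3 * t^2 ≤ CC n t := by
      have : 0 ≤ (n:ℝ) * t^2 := by positivity
      nlinarith
    calc 3.6 * (t^2 - 2/3 * n^3 * t^4) = (1 - 2/3 * n^3 * t^2) * (4 * (9/10 * t^2)) := by ring
      _ ≤ CC n t * (4 * (9/10 * t^2)) := by gcongr
      _ ≤ CC n t * (4 * (sin t ^2 * cos t)) := by gcongr
      _ = G t := by simp only [hG]; ring
  rw [← intervalIntegral.integral_add_adjacent_intervals (hi (-(π/2)) (-d)) (hi _ (π/2)),
    ← intervalIntegral.integral_add_adjacent_intervals (hi (-d) d) (hi _ (π/2))]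
  have i1 : ∫ θ in (-(π/2))..(-d), (-(4 * (d^3/80))) ≤ ∫ θ in (-(π/2))..(-d), G θ := by
    apply intervalIntegral.integral_mono_on (by linarith) (by simp) (hi _ _)
    intro x hx
    exact heps x (abs_le.mpr ⟨by linarith [hx.1], by linarith [hx.2]⟩)
  have i3 : ∫ θ in (d)..(π/2), (-(4 * (d^3/80))) ≤ ∫ θ in d..(π/2), G θ := by
    apply intervalIntegral.integral_mono_on (by linarith) (by simp) (hi _ _)
    intro x hx
    exact heps x (abs_le.mpr ⟨by linarith [hx.1], by linarith [hx.2]⟩)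
  have i2 : ∫ θ in (-d)..d, 3.6 * (θ^2 - 2/3 * n^3 * θ^4) ≤ ∫ θ in (-d)..d, G θ := by
    apply intervalIntegral.integral_mono_on (by linarith) (Continuous.intervalIntegrable (by fun_prop) _ _) (hi _ _)
    intro x hx
    exact hmid x (abs_le.mpr ⟨by linarith [hx.1], by linarith [hx.2]⟩)
  have i2' : ∫ θ in (-d)..d, 3.6 * (θ^2 - 2/3 * n^3 * θ^4) = 1.44 * d^3 := by
    rw [intervalIntegral.integral_const_mul, intervalIntegral.integral_sub, intervalIntegral.integral_const_mul, integral_pow, integral_pow]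
    · have : (n:ℝ)^3 * d^5 = d^3 := by
        calc (n:ℝ)^3 * d^5 = (d^2*n^3) * d^3 := by ring
          _ = _ := by rw [hdn, one_mul]
      push_cast
      norm_num
      ring_nf
      ring_nf at this
      linarith
    all_goals exact Continuous.intervalIntegrable (by fun_prop) _ _
  rw [intervalIntegral.integral_const, smul_eq_mul] at i1 i3
  have h5 : 0 ≤ d^3 := by positivity
  have h6 : 0 ≤ d^3 * d := by positivity
  rw [i2'] at i2
  nlinarith

theorem big (r : ℕ) (hr : 100 ≤ r) :
    (b (2 * r * (r + 1)) (2 * r + 1) : ℝ) - b (2 * r * (r + 1) - 1) (2 * r + 1) ≥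
      4 ^ r / (3 * (2 * (r : ℝ)) ^ ((9 : ℝ) / 2)) := by
  have hr' : (100:ℝ) ≤ r := by exact_mod_cast hr
  rw [diff_eq r (by omega)]
  set n : ℕ := 2 * r + 1 with hn
  have hnr : (n:ℝ) = 2 * r + 1 := by rw [hn]; push_cast; ring
  have hn0 : (0:ℝ) < n := by rw [hnr]; linarith
  set d : ℝ := (n:ℝ) ^ (-(3/2) : ℝ) with hd
  have hd0 : 0 < d := by positivity
  have hdn : d^2 * (n:ℝ)^3 = 1 := by
    rw [hd, ← rpow_natCast, ← rpow_mul hn0.le, ← rpow_natCast, ← rpow_add hn0]; norm_num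
  have hI := int_lower n (by omega) d hd0 hdn
  set y : ℝ := (2 * (r:ℝ)) ^ ((9 : ℝ) / 2) with hy
  have hy0 : 0 < y := by positivity
  have hy2 : y^2 = (2 * (r:ℝ))^9 := by
    rw [hy, ← rpow_natCast, ← rpow_mul (by positivity), ← rpow_natCast]; norm_num
  have hyd : 1 ≤ 1.5 * d^3 * y := by
    by_contra hcon
    push Not at hcon
    have h1 : (1.5 * d^3*y)^2 < 1 := by
      have : 0 < 1.5 * d^3 * y := by positivity
      nlinarith
    have h2 : (1.5 * d^3*y)^2 = 2.25 * (d^2 * (2*r)^3)^3 := by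
      calc (1.5 * d^3*y)^2 = 2.25 * d^6 * y^2 := by ring
        _ = _ := by rw [hy2]; ring
    have h3 : (0.98:ℝ) ≤ d^2 * (2*r)^3 := by
      have h4 : 200/201 * (n:ℝ) ≤ 2 * r := by rw [hnr]; linarith
      calc (0.98:ℝ) ≤ (200/201)^3 * (d^2 * n^3) := by rw [hdn]; norm_num
        _ = d^2 * (200/201*n)^3 := by ring
        _ ≤ _ := by gcongr
    have h5 : (0.98:ℝ)^3 ≤ (d^2 * (2*r)^3)^3 := by gcongr
    norm_num at h5
    linarith
  have hpi := pi_gt_three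
  have hpi2 := pi_lt_d2
  have e : (2:ℝ)^n = 2 * 4^r := by rw [hn, pow_succ, pow_mul]; norm_num; ring
  rw [ge_iff_le, e]
  have hd3 : 0 < d^3 := by positivity
  calc (4:ℝ)^r / (3 * y) ≤ 4^r * (0.5 * d^3) := by
        rw [div_le_iff₀ (by positivity)]
        have : (0:ℝ) < 4^r := by positivity
        nlinarith
    _ ≤ 4^r * (2 / π * (1.44 * d^3 - 4 * π * (d^3 / 80))) := by
        apply mul_le_mul_of_nonneg_left _ (by positivity)
        rw [div_mul_eq_mul_div, le_div_iff₀ (by linarith)]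
        nlinarith
    _ = 2 * 4^r / π * (1.44 * d^3 - 4 * π * (d^3 / 80)) := by ring
    _ ≤ _ := by gcongr

end

theorem small (r : ℕ) (hr : 4 ≤ r) (hr2 : r < 100) :
    (b (2 * r * (r + 1)) (2 * r + 1) : ℝ) - b (2 * r * (r + 1) - 1) (2 * r + 1) ≥
      4 ^ r / (3 * (2 * (r : ℝ)) ^ ((9 : ℝ) / 2)) := by
  have h := chk_all r hr2 hr
  unfold chk at h
  rw [← b_digit _ _ _ (by omega), ← b_digit _ _ _ (by omega)] at h
  have h1 := Nat.le_of_ble_eq_true h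
  clear h
  generalize b (2 * r * (r + 1)) (2 * r + 1) = x at *
  generalize b (2 * r * (r + 1) - 1) (2 * r + 1) = z at *
  have h2 : (4:ℝ)^r + 3 * (2 * r)^4 * (Nat.sqrt (2*r) : ℝ) * z ≤ 3 * (2 * r)^4 * (Nat.sqrt (2*r) : ℝ) * x := by
    exact_mod_cast h1
  have hr' : (4:ℝ) ≤ r := by exact_mod_cast hr
  have hs0 : (Nat.sqrt (2*r) : ℝ) ≤ √(2 * r) := by
    have := Real.nat_sqrt_le_real_sqrt (a := 2 * r)
    push_cast at this; exact this
  have hy : (2 * (r : ℝ)) ^ ((9 : ℝ) / 2) = (2 * r)^4 * √(2*r) := by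
    rw [Real.sqrt_eq_rpow, ← Real.rpow_natCast, ← Real.rpow_add (by linarith)]; norm_num
  have hs1 : 0 < √(2 * (r:ℝ)) := Real.sqrt_pos.2 (by linarith)
  rw [hy, ge_iff_le, div_le_iff₀ (by positivity)]
  have h4 : (0:ℝ) < 4^r := by positivity
  have h5 : 0 ≤ (x:ℝ) - z := by
    by_contra hc
    push Not at hc
    have : 0 ≤ 3 * (2 * (r:ℝ))^4 * (Nat.sqrt (2*r) : ℝ) := by positivity
    nlinarith
  calc (4:ℝ)^r ≤ (x - z) * (3 * ((2 * r)^4 * (Nat.sqrt (2*r) : ℝ))) := by linarith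
    _ ≤ _ := by gcongr

theorem stmt_14 (r : ℕ) (hr : 4 ≤ r) :
    (b (2 * r * (r + 1)) (2 * r + 1) : ℝ) - b (2 * r * (r + 1) - 1) (2 * r + 1) ≥
      4 ^ r / (3 * (2 * (r : ℝ)) ^ ((9 : ℝ) / 2)) := by
  rcases lt_or_ge r 100 with h | h
  · exact small r hr h
  · exact big r h
end
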